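/- arXiv:1810.01223 — 2 statements merged into one kernel-verified Lean document; each statement's English description precedes it below -/
import Mathlib

section
/- (Theorem 4.3 (ii), 3/2-dual approximation for nice preemptive instances.) Let T > 0 with s_i + t_j ≤ T for every class i and every job j ∈ C_i. Define I_exp = { i : s_i > T/2 }, I_chp = { i : s_i ≤ T/2 }, I_exp^+ = { i ∈ I_exp : T ≤ s_i + P(C_i) }, I_exp^0 = { i ∈ I_exp : (3/4)T < s_i + P(C_i) < T }, I_exp^- = { i ∈ I_exp : s_i + P(C_i) ≤ (3/4)T }, and α_i' = ⌊P(C_i)/(T − s_i)⌋. Assume the instance is nice for T, i.e. I_exp^0 = ∅. Let L_nice = P(J) + Σ_{i∈I_exp^+} α_i'·s_i + Σ_{i∈I_exp^- ∪ I_chp} s_i and m_nice = ⌈|I_exp^-|/2⌉ + Σ_{i∈I_exp^+} α_i'. If m·T ≥ L_nice and m ≥ m_nice, then there exists a feasible preemptive schedule with makespan at most (3/2)·T. -/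
open Classical Finset

/-- A feasible preemptive schedule with makespan at most `M` for an instance of scheduling
with batch setup times: machines `υ`, classes `γ`, jobs `ι`, class assignment `cl`,
processing times `t`, setup times `s`. Each job `j` is given a finite set of job pieces
`(u, a, b)` (job `j` runs on machine `u` during `(a, b)`), the pieces of one job are
pairwise disjoint in time (no parallelization) and their lengths sum to `t j`; each machine
carries finitely many setup intervals `(i, a)` representing the interval `(a, a + s i)`;
on each machine all job-piece and setup intervals are pairwise disjoint, and every job
piece of a class-`i` job is preceded by a class-`i` setup on the same machine with no
foreign setup or foreign job piece intersecting the time in between. -/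
structure PSchedule (υ : Type*) {γ ι : Type*} [Fintype υ] [Fintype γ] [Fintype ι]
    (cl : ι → γ) (t : ι → ℝ) (s : γ → ℝ) (M : ℝ) where
  pieces : ι → Finset (υ × ℝ × ℝ)
  setups : υ → Finset (γ × ℝ)
  pieces_bounds : ∀ j, ∀ p ∈ pieces j, 0 ≤ p.2.1 ∧ p.2.1 < p.2.2 ∧ p.2.2 ≤ M
  pieces_no_parallel : ∀ j, ∀ p ∈ pieces j, ∀ q ∈ pieces j, p ≠ q →
    p.2.2 ≤ q.2.1 ∨ q.2.2 ≤ p.2.1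
  pieces_sum : ∀ j, (∑ p ∈ pieces j, (p.2.2 - p.2.1)) = t j
  setup_bounds : ∀ u, ∀ q ∈ setups u, 0 ≤ q.2 ∧ q.2 + s q.1 ≤ M
  machine_pieces_disjoint : ∀ (j₁ j₂ : ι), ∀ p₁ ∈ pieces j₁, ∀ p₂ ∈ pieces j₂,
    p₁.1 = p₂.1 → (j₁ ≠ j₂ ∨ p₁ ≠ p₂) → p₁.2.2 ≤ p₂.2.1 ∨ p₂.2.2 ≤ p₁.2.1
  machine_setups_disjoint : ∀ (u : υ), ∀ q₁ ∈ setups u, ∀ q₂ ∈ setups u, q₁ ≠ q₂ →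
    q₁.2 + s q₁.1 ≤ q₂.2 ∨ q₂.2 + s q₂.1 ≤ q₁.2
  machine_piece_setup_disjoint : ∀ (j : ι), ∀ p ∈ pieces j, ∀ q ∈ setups p.1,
    p.2.2 ≤ q.2 ∨ q.2 + s q.1 ≤ p.2.1
  setup_before : ∀ (j : ι), ∀ p ∈ pieces j, ∃ a' : ℝ, (cl j, a') ∈ setups p.1 ∧
    a' + s (cl j) ≤ p.2.1 ∧
    (∀ q ∈ setups p.1, q.1 ≠ cl j → ¬ (q.2 < p.2.1 ∧ a' + s (cl j) < q.2 + s q.1)) ∧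
    (∀ j' : ι, cl j' ≠ cl j → ∀ p' ∈ pieces j', p'.1 = p.1 →
      ¬ (p'.2.1 < p.2.1 ∧ a' + s (cl j) < p'.2.2))

/-- The load of machine `u` in a preemptive schedule: the total length of all job-piece
and setup intervals on `u`. -/
noncomputable def pLoad {υ γ ι : Type*} [Fintype υ] [Fintype γ] [Fintype ι]
    {cl : ι → γ} {t : ι → ℝ} {s : γ → ℝ} {M : ℝ}
    (σ : PSchedule υ cl t s M) (u : υ) : ℝ :=
  (∑ j, ∑ p ∈ (σ.pieces j).filter (fun p => p.1 = u), (p.2.2 - p.2.1)) +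
  (∑ q ∈ σ.setups u, s q.1)

structure Good {υ γ ι : Type*} [Fintype υ] [Fintype γ] [Fintype ι]
    (cl : ι → γ) (s : γ → ℝ) (M : ℝ)
    (pc : ι → Finset (υ × ℝ × ℝ)) (su : υ → Finset (γ × ℝ)) (e : υ → ℝ) (o : υ → Option γ) :
    Prop where
  pb : ∀ j, ∀ p ∈ pc j, 0 ≤ p.2.1 ∧ p.2.1 < p.2.2 ∧ p.2.2 ≤ e p.1
  sb : ∀ u, ∀ q ∈ su u, 0 ≤ q.2 ∧ q.2 + s q.1 ≤ e u
  eb : ∀ u, 0 ≤ e u ∧ e u ≤ M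
  np : ∀ j, ∀ p ∈ pc j, ∀ q ∈ pc j, p ≠ q → p.2.2 ≤ q.2.1 ∨ q.2.2 ≤ p.2.1
  pd : ∀ (j₁ j₂ : ι), ∀ p₁ ∈ pc j₁, ∀ p₂ ∈ pc j₂,
    p₁.1 = p₂.1 → (j₁ ≠ j₂ ∨ p₁ ≠ p₂) → p₁.2.2 ≤ p₂.2.1 ∨ p₂.2.2 ≤ p₁.2.1
  sd : ∀ (u : υ), ∀ q₁ ∈ su u, ∀ q₂ ∈ su u, q₁ ≠ q₂ →
    q₁.2 + s q₁.1 ≤ q₂.2 ∨ q₂.2 + s q₂.1 ≤ q₁.2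
  ps : ∀ (j : ι), ∀ p ∈ pc j, ∀ q ∈ su p.1, p.2.2 ≤ q.2 ∨ q.2 + s q.1 ≤ p.2.1
  bf : ∀ (j : ι), ∀ p ∈ pc j, ∃ a' : ℝ, (cl j, a') ∈ su p.1 ∧
    a' + s (cl j) ≤ p.2.1 ∧
    (∀ q ∈ su p.1, q.1 ≠ cl j → ¬ (q.2 < p.2.1 ∧ a' + s (cl j) < q.2 + s q.1)) ∧
    (∀ j' : ι, cl j' ≠ cl j → ∀ p' ∈ pc j', p'.1 = p.1 →
      ¬ (p'.2.1 < p.2.1 ∧ a' + s (cl j) < p'.2.2))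
  op : ∀ u i, o u = some i → ∃ a' : ℝ, (i, a') ∈ su u ∧
    (∀ q ∈ su u, q.1 ≠ i → q.2 + s q.1 ≤ a' + s i) ∧
    (∀ j' : ι, cl j' ≠ i → ∀ p' ∈ pc j', p'.1 = u → p'.2.2 ≤ a' + s i)

section helpers

set_option linter.unusedSectionVars false

variable {υ γ ι : Type*} [Fintype υ] [Fintype γ] [Fintype ι]
    {cl : ι → γ} {t : ι → ℝ} {s : γ → ℝ} {M : ℝ}
    {pc : ι → Finset (υ × ℝ × ℝ)} {su : υ → Finset (γ × ℝ)} {e : υ → ℝ} {o : υ → Option γ}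

theorem mem_upd_pc {j j' : ι} {x p : υ × ℝ × ℝ} :
    p ∈ Function.update pc j (insert x (pc j)) j' ↔ (j' = j ∧ p = x) ∨ p ∈ pc j' := by
  by_cases h : j' = j
  · subst h; simp
  · simp [h]

theorem mem_upd_su {u u' : υ} {x p : γ × ℝ} :
    p ∈ Function.update su u (insert x (su u)) u' ↔ (u' = u ∧ p = x) ∨ p ∈ su u' := by
  by_cases h : u' = u
  · subst h; simp
  · simp [h]

theorem Good.addPiece (G : Good cl s M pc su e o) {u : υ} {j : ι} {a b : ℝ}
    (ho : o u = some (cl j)) (ha : e u ≤ a) (hab : a < b) (hb : b ≤ M)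
    (hd : ∀ p ∈ pc j, p.2.2 ≤ a ∨ b ≤ p.2.1) :
    Good cl s M (Function.update pc j (insert (u, a, b) (pc j))) su (Function.update e u b) o := by
  have he : ∀ v, e v ≤ Function.update e u b v := by
    intro v
    by_cases h : v = u
    · subst h; simp; linarith
    · simp [h]
  have hu := (G.eb u).1
  constructor
  · intro j' p hp
    rcases mem_upd_pc.1 hp with ⟨rfl, rfl⟩ | hp
    · simp; exact ⟨by linarith, hab⟩
    · obtain ⟨h1, h2, h3⟩ := G.pb j' p hp
      exact ⟨h1, h2, h3.trans (he _)⟩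
  · intro v q hq
    obtain ⟨h1, h2⟩ := G.sb v q hq
    exact ⟨h1, h2.trans (he _)⟩
  · intro v
    by_cases h : v = u
    · subst h; simp; exact ⟨by linarith, hb⟩
    · simp [h]; exact G.eb v
  · intro j' p hp q hq hpq
    rcases mem_upd_pc.1 hp with ⟨rfl, rfl⟩ | hp1
    · rcases mem_upd_pc.1 hq with ⟨_, rfl⟩ | hq
      · exact absurd rfl hpq
      · exact (hd q hq).symm
    · rcases mem_upd_pc.1 hq with ⟨rfl, rfl⟩ | hq
      · exact hd p hp1
      · exact G.np j' p hp1 q hq hpq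
  · intro j₁ j₂ p₁ hp₁ p₂ hp₂ hm hne
    rcases mem_upd_pc.1 hp₁ with ⟨rfl, rfl⟩ | hp₁'
    · rcases mem_upd_pc.1 hp₂ with ⟨rfl, rfl⟩ | hp₂'
      · simp at hne
      · right
        have := (G.pb _ _ hp₂').2.2
        simp only at hm
        rw [← hm] at this
        exact this.trans ha
    · rcases mem_upd_pc.1 hp₂ with ⟨rfl, rfl⟩ | hp₂'
      · left
        have := (G.pb _ _ hp₁').2.2
        simp only at hm
        rw [hm] at this
        exact this.trans ha
      · exact G.pd j₁ j₂ p₁ hp₁' p₂ hp₂' hm hne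
  · exact G.sd
  · intro j' p hp q hq
    rcases mem_upd_pc.1 hp with ⟨rfl, rfl⟩ | hp
    · right; exact (G.sb _ q hq).2.trans ha
    · exact G.ps j' p hp q hq
  · intro j' p hp
    rcases mem_upd_pc.1 hp with ⟨rfl, rfl⟩ | hp1
    · obtain ⟨a', h1, h2, h3⟩ := G.op u _ ho
      refine ⟨a', h1, ((G.sb _ _ h1).2.trans ha), ?_, ?_⟩
      · rintro q hq hqi ⟨_, h⟩
        linarith [h2 q hq hqi]
      · rintro j'' hj'' p' hp' hpu ⟨_, h⟩
        rcases mem_upd_pc.1 hp' with ⟨rfl, rfl⟩ | hp'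
        · exact hj'' rfl
        · linarith [h3 j'' hj'' p' hp' hpu]
    · obtain ⟨a', h1, h2, h3, h4⟩ := G.bf j' p hp1
      refine ⟨a', h1, h2, h3, ?_⟩
      rintro j'' hj'' p' hp' hpu ⟨h5, h6⟩
      rcases mem_upd_pc.1 hp' with ⟨rfl, rfl⟩ | hp'
      · have := G.pb _ _ hp1
        simp only at hpu h5
        rw [← hpu] at this
        linarith [this.2.2, this.2.1]
      · exact h4 j'' hj'' p' hp' hpu ⟨h5, h6⟩
  · intro v i hv
    obtain ⟨a', h1, h2, h3⟩ := G.op v i hv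
    refine ⟨a', h1, h2, ?_⟩
    intro j' hj' p' hp' hpu
    rcases mem_upd_pc.1 hp' with ⟨rfl, rfl⟩ | hp'
    · simp only at hpu
      subst hpu
      rw [ho] at hv
      exact absurd (Option.some.inj hv) hj'
    · exact h3 j' hj' p' hp' hpu

theorem Good.addSetup (hs : ∀ i, 0 < s i) (G : Good cl s M pc su e o) {u : υ} {i : γ} {a : ℝ}
    (ha : e u ≤ a) (hb : a + s i ≤ M) :
    Good cl s M pc (Function.update su u (insert (i, a) (su u)))
      (Function.update e u (a + s i)) (Function.update o u (some i)) := by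
  have hsi := hs i
  have he : ∀ v, e v ≤ Function.update e u (a + s i) v := by
    intro v
    by_cases h : v = u
    · subst h; simp; linarith
    · simp [h]
  have hu := (G.eb u).1
  constructor
  · intro j' p hp
    obtain ⟨h1, h2, h3⟩ := G.pb j' p hp
    exact ⟨h1, h2, h3.trans (he _)⟩
  · intro v q hq
    rcases mem_upd_su.1 hq with ⟨rfl, rfl⟩ | hq
    · simp; linarith
    · obtain ⟨h1, h2⟩ := G.sb v q hq
      exact ⟨h1, h2.trans (he _)⟩
  · intro v
    by_cases h : v = u
    · subst h; simp; exact ⟨by linarith, hb⟩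
    · simp [h]; exact G.eb v
  · exact G.np
  · exact G.pd
  · intro v q₁ hq₁ q₂ hq₂ hne
    rcases mem_upd_su.1 hq₁ with ⟨rfl, rfl⟩ | hq₁'
    · rcases mem_upd_su.1 hq₂ with ⟨_, rfl⟩ | hq₂'
      · exact absurd rfl hne
      · right; exact (G.sb _ _ hq₂').2.trans ha
    · rcases mem_upd_su.1 hq₂ with ⟨rfl, rfl⟩ | hq₂'
      · left; exact (G.sb _ _ hq₁').2.trans ha
      · exact G.sd v q₁ hq₁' q₂ hq₂' hne
  · intro j p hp q hq
    rcases mem_upd_su.1 hq with ⟨h, rfl⟩ | hq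
    · left
      have := (G.pb j p hp).2.2
      rw [h] at this
      exact this.trans ha
    · exact G.ps j p hp q hq
  · intro j p hp
    obtain ⟨a', h1, h2, h3, h4⟩ := G.bf j p hp
    refine ⟨a', mem_upd_su.2 (Or.inr h1), h2, ?_, h4⟩
    rintro q hq hqi ⟨h5, h6⟩
    rcases mem_upd_su.1 hq with ⟨h, rfl⟩ | hq
    · have := G.pb j p hp
      rw [h] at this
      simp only at h5
      linarith [this.2.1, this.2.2]
    · exact h3 q hq hqi ⟨h5, h6⟩
  · intro v i' hv
    by_cases h : v = u
    · subst h
      simp at hv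
      subst hv
      refine ⟨a, by simp, ?_, ?_⟩
      · intro q hq hqi
        rcases mem_upd_su.1 hq with ⟨_, rfl⟩ | hq
        · exact absurd rfl hqi
        · linarith [(G.sb _ q hq).2]
      · intro j' _ p' hp' hpu
        have := (G.pb _ _ hp').2.2
        rw [hpu] at this
        linarith
    · simp [h] at hv
      obtain ⟨a', h1, h2, h3⟩ := G.op v i' hv
      refine ⟨a', mem_upd_su.2 (Or.inr h1), ?_, h3⟩
      intro q hq hqi
      rcases mem_upd_su.1 hq with ⟨h', _⟩ | hq
      · exact absurd h' h
      · exact h2 q hq hqi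

/-- State with current machine `u` and free machines `F`. -/
def Cur (cl : ι → γ) (s : γ → ℝ) (M : ℝ) (pc : ι → Finset (υ × ℝ × ℝ)) (e : υ → ℝ)
    (o : υ → Option γ) (u : υ) (F : Finset υ) : Prop :=
  (∃ su, Good cl s M pc su e o) ∧ u ∉ F ∧ ∀ v ∈ F, e v = 0

theorem Cur.newMachine (hs : ∀ i, 0 < s i) {u : υ} {F : Finset υ} {i : γ} {B : ℝ}
    (C : Cur cl s M pc e o u F) (hB : s i ≤ B) (hBM : B < M) (hF : F.Nonempty) :
    ∃ (e' : υ → ℝ) (o' : υ → Option γ) (v : υ) (F' : Finset υ),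
      Cur cl s M pc e' o' v F' ∧ v ∈ F ∧ F' ⊆ F ∧ o' v = some i ∧ e' v = B ∧
      (F.card : ℝ) = F'.card + 1 ∧ (∀ w, w ∉ insert u F → e' w = e w) := by
  obtain ⟨⟨su, G⟩, hu, hf⟩ := C
  obtain ⟨v, hv⟩ := hF
  have hG := G.addSetup hs (u := v) (i := i) (a := B - s i)
    (by rw [hf v hv]; linarith) (by linarith)
  refine ⟨_, _, v, F.erase v, ⟨⟨_, hG⟩, by simp, ?_⟩, hv, erase_subset _ _, by simp, by simp, ?_, ?_⟩
  · intro w hw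
    rw [mem_erase] at hw
    simp [hw.1, hf w hw.2]
  · rw [← card_erase_add_one hv]; push_cast; rfl
  · intro w hw
    have : w ≠ v := by rintro rfl; simp [hv] at hw
    simp [this]

theorem Cur.addJob (hs : ∀ i, 0 < s i) (ht : ∀ j, 0 < t j) {u : υ} {F : Finset υ} {j : ι} {B : ℝ}
    (C : Cur cl s M pc e o u F) (ho : o u = some (cl j)) (hB : s (cl j) ≤ B) (hBM : B < M)
    (htj : t j ≤ M - B) (hj : pc j = ∅)
    (hcap : t j ≤ (M - e u) + F.card * (M - B)) :
    ∃ (pc' : ι → Finset (υ × ℝ × ℝ)) (e' : υ → ℝ) (o' : υ → Option γ) (u' : υ) (F' : Finset υ),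
      Cur cl s M pc' e' o' u' F' ∧ u' ∈ insert u F ∧ F' ⊆ F ∧ o' u' = some (cl j) ∧
      (M - e u) + F.card * (M - B) - t j ≤ (M - e' u') + F'.card * (M - B) ∧
      (∀ w, w ∉ insert u F → e' w = e w) ∧ (∀ k, k ≠ j → pc' k = pc k) ∧
      ∑ p ∈ pc' j, (p.2.2 - p.2.1) = t j := by
  have htp := ht j
  by_cases hc : e u + t j ≤ M
  · obtain ⟨⟨su, G⟩, hu, hf⟩ := C
    have hG := G.addPiece ho le_rfl (b := e u + t j) (by linarith) hc (by simp [hj])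
    refine ⟨_, _, _, u, F, ⟨⟨su, hG⟩, hu, ?_⟩, by simp, Subset.rfl, ho, ?_, ?_, ?_, ?_⟩
    · intro v hv
      have : v ≠ u := by rintro rfl; exact hu hv
      simp [this, hf v hv]
    · simp; linarith
    · intro w hw
      have : w ≠ u := by rintro rfl; simp at hw
      simp [this]
    · intro k hk; simp [hk]
    · simp [hj]
  · have hF : F.Nonempty := by
      rw [nonempty_iff_ne_empty]; rintro rfl
      simp at hcap; linarith
    have heu : e u ≤ M := by obtain ⟨⟨su, G⟩, _, _⟩ := C; exact (G.eb u).2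
    rcases heu.lt_or_eq with hlt | heq
    · -- first piece
      have C1 : Cur cl s M (Function.update pc j (insert (u, e u, M) (pc j)))
          (Function.update e u M) o u F := by
        obtain ⟨⟨su, G⟩, hu, hf⟩ := C
        refine ⟨⟨su, G.addPiece ho le_rfl hlt le_rfl (by simp [hj])⟩, hu, ?_⟩
        intro v hv
        have : v ≠ u := by rintro rfl; exact hu hv
        simp [this, hf v hv]
      obtain ⟨e', o', v, F', C2, hv, hFF, hov, hev, hcard, hfr⟩ := C1.newMachine hs hB hBM hF
      obtain ⟨⟨su, G⟩, hvF, hf⟩ := C2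
      have huF := C.2.1
      have hvu : v ≠ u := by rintro rfl; exact huF hv
      have hG := G.addPiece hov hev.le (b := B + (t j - (M - e u))) (by linarith) (by linarith)
        (by simp [hj]; right; linarith)
      refine ⟨_, _, _, v, F', ⟨⟨su, hG⟩, hvF, ?_⟩, by simp [hv], hFF, hov, ?_, ?_, ?_, ?_⟩
      · intro w hw
        have : w ≠ v := by rintro rfl; exact hvF hw
        simp [this, hf w hw]
      · simp only [Function.update_self]; rw [hcard]; linarith
      · intro w hw
        have h1 : w ≠ v := by rintro rfl; simp [hv] at hw
        have h2 : w ≠ u := by rintro rfl; simp at hw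
        simp only [Function.update_of_ne h1]
        rw [hfr w hw]; simp [h2]
      · intro k hk; simp [hk]
      · simp only [Function.update_self, hj]
        rw [sum_insert (by simp [hvu])]
        simp
    · obtain ⟨e', o', v, F', C2, hv, hFF, hov, hev, hcard, hfr⟩ := C.newMachine hs hB hBM hF
      obtain ⟨⟨su, G⟩, hvF, hf⟩ := C2
      have hG := G.addPiece hov hev.le (b := B + t j) (by linarith) (by linarith)
        (by simp [hj])
      refine ⟨_, _, _, v, F', ⟨⟨su, hG⟩, hvF, ?_⟩, by simp [hv], hFF, hov, ?_, ?_, ?_, ?_⟩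
      · intro w hw
        have : w ≠ v := by rintro rfl; exact hvF hw
        simp [this, hf w hw]
      · simp only [Function.update_self]; rw [hcard]; linarith
      · intro w hw
        have h1 : w ≠ v := by rintro rfl; simp [hv] at hw
        simp only [Function.update_of_ne h1]
        rw [hfr w hw]
      · intro k hk; simp [hk]
      · simp [hj]

theorem Cur.addJobs (hs : ∀ i, 0 < s i) (ht : ∀ j, 0 < t j) {u : υ} {F : Finset υ} {i : γ} {B : ℝ}
    (C : Cur cl s M pc e o u F) (ho : o u = some i) (hB : s i ≤ B) (hBM : B < M)
    (S : Finset ι) (hS : ∀ j ∈ S, cl j = i ∧ t j ≤ M - B ∧ pc j = ∅)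
    (hcap : ∑ j ∈ S, t j ≤ (M - e u) + F.card * (M - B)) :
    ∃ (pc' : ι → Finset (υ × ℝ × ℝ)) (e' : υ → ℝ) (o' : υ → Option γ) (u' : υ) (F' : Finset υ),
      Cur cl s M pc' e' o' u' F' ∧ u' ∈ insert u F ∧ F' ⊆ F ∧ o' u' = some i ∧
      (M - e u) + F.card * (M - B) - ∑ j ∈ S, t j ≤ (M - e' u') + F'.card * (M - B) ∧
      (∀ w, w ∉ insert u F → e' w = e w) ∧ (∀ k, k ∉ S → pc' k = pc k) ∧
      ∀ j ∈ S, ∑ p ∈ pc' j, (p.2.2 - p.2.1) = t j := by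
  induction S using Finset.induction_on with
  | empty =>
    exact ⟨pc, e, o, u, F, C, by simp, Subset.rfl, ho, by simp, by simp, by simp, by simp⟩
  | insert j S hjS ih =>
    rw [sum_insert hjS] at hcap
    have htp := ht j
    obtain ⟨pc1, e1, o1, u1, F1, C1, hu1, hF1, ho1, hcap1, hfr1, hpc1, hsum1⟩ :=
      ih (fun k hk => hS k (mem_insert_of_mem hk)) (by linarith)
    obtain ⟨hji, htj, hj⟩ := hS j (mem_insert_self _ _)
    subst hji
    obtain ⟨pc2, e2, o2, u2, F2, C2, hu2, hF2, ho2, hcap2, hfr2, hpc2, hsum2⟩ :=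
      C1.addJob hs ht (j := j) (B := B) ho1 hB hBM htj (by rw [hpc1 j hjS, hj]) (by linarith)
    have hsub : insert u1 F1 ⊆ insert u F :=
      insert_subset hu1 (hF1.trans (subset_insert _ _))
    refine ⟨pc2, e2, o2, u2, F2, C2, hsub hu2, hF2.trans hF1, ho2, ?_, ?_, ?_, ?_⟩
    · rw [sum_insert hjS]; linarith
    · intro w hw
      rw [hfr2 w (fun h => hw (hsub h)), hfr1 w hw]
    · intro k hk
      rw [mem_insert, not_or] at hk
      rw [hpc2 k hk.1, hpc1 k hk.2]
    · intro k hk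
      rcases mem_insert.1 hk with rfl | hk1
      · exact hsum2
      · rw [hpc2 k (by rintro rfl; exact hjS hk1), hsum1 k hk1]

theorem Cur.addClass (hs : ∀ i, 0 < s i) (ht : ∀ j, 0 < t j) {u : υ} {F : Finset υ} {i : γ} {B : ℝ}
    (C : Cur cl s M pc e o u F) (hB : s i ≤ B) (hBM : B < M)
    (hS : ∀ j, cl j = i → t j ≤ M - B ∧ pc j = ∅)
    (hcap : s i + ∑ j ∈ univ.filter (fun j => cl j = i), t j ≤ (M - e u) + F.card * (M - B)) :
    ∃ (pc' : ι → Finset (υ × ℝ × ℝ)) (e' : υ → ℝ) (o' : υ → Option γ) (u' : υ) (F' : Finset υ),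
      Cur cl s M pc' e' o' u' F' ∧ u' ∈ insert u F ∧ F' ⊆ F ∧
      (M - e u) + F.card * (M - B) - (s i + ∑ j ∈ univ.filter (fun j => cl j = i), t j)
        ≤ (M - e' u') + F'.card * (M - B) ∧
      (∀ w, w ∉ insert u F → e' w = e w) ∧ (∀ k, cl k ≠ i → pc' k = pc k) ∧
      ∀ j, cl j = i → ∑ p ∈ pc' j, (p.2.2 - p.2.1) = t j := by
  have hsum0 : 0 ≤ ∑ j ∈ univ.filter (fun j => cl j = i), t j := sum_nonneg fun j _ => (ht j).le
  have h1 : ∃ (e' : υ → ℝ) (o' : υ → Option γ) (u' : υ) (F' : Finset υ),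
      Cur cl s M pc e' o' u' F' ∧ u' ∈ insert u F ∧ F' ⊆ F ∧ o' u' = some i ∧
      (M - e u) + F.card * (M - B) - s i ≤ (M - e' u') + F'.card * (M - B) ∧
      (∀ w, w ∉ insert u F → e' w = e w) := by
    by_cases hc : e u + s i ≤ M
    · obtain ⟨⟨su, G⟩, hu, hf⟩ := C
      have hG := G.addSetup hs (u := u) (i := i) le_rfl hc
      refine ⟨_, _, u, F, ⟨⟨_, hG⟩, hu, ?_⟩, by simp, Subset.rfl, by simp, ?_, ?_⟩
      · intro v hv
        have : v ≠ u := by rintro rfl; exact hu hv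
        simp [this, hf v hv]
      · simp; linarith
      · intro w hw
        have : w ≠ u := by rintro rfl; simp at hw
        simp [this]
    · have hF : F.Nonempty := by
        rw [nonempty_iff_ne_empty]; rintro rfl
        simp at hcap; linarith
      obtain ⟨e', o', v, F', C2, hv, hFF, hov, hev, hcard, hfr⟩ := C.newMachine hs hB hBM hF
      refine ⟨e', o', v, F', C2, by simp [hv], hFF, hov, ?_, hfr⟩
      rw [hev, hcard]; linarith
  obtain ⟨e1, o1, u1, F1, C1, hu1, hF1, ho1, hcap1, hfr1⟩ := h1
  obtain ⟨pc2, e2, o2, u2, F2, C2, hu2, hF2, ho2, hcap2, hfr2, hpc2, hsum2⟩ :=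
    C1.addJobs hs ht ho1 hB hBM (univ.filter (fun j => cl j = i))
      (fun j hj => ⟨(mem_filter.1 hj).2, hS j (mem_filter.1 hj).2⟩) (by linarith)
  have hsub : insert u1 F1 ⊆ insert u F :=
    insert_subset hu1 (hF1.trans (subset_insert _ _))
  refine ⟨pc2, e2, o2, u2, F2, C2, hsub hu2, hF2.trans hF1, by linarith, ?_, ?_, ?_⟩
  · intro w hw
    rw [hfr2 w (fun h => hw (hsub h)), hfr1 w hw]
  · intro k hk
    exact hpc2 k (by simp [hk])
  · intro k hk
    exact hsum2 k (by simp [hk])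

/-- Classes in `D` are done, the machines in `F` are free. `u` is a current machine with load
at most `x` -/
def Main (cl : ι → γ) (t : ι → ℝ) (s : γ → ℝ) (M : ℝ) (D : Finset γ) (F : Finset υ)
    (Q : (υ → ℝ) → Prop) : Prop :=
  ∃ (pc : ι → Finset (υ × ℝ × ℝ)) (su : υ → Finset (γ × ℝ)) (e : υ → ℝ) (o : υ → Option γ),
    Good cl s M pc su e o ∧ (∀ v ∈ F, e v = 0) ∧ Q e ∧
    (∀ j, cl j ∈ D → ∑ p ∈ pc j, (p.2.2 - p.2.1) = t j) ∧ (∀ j, cl j ∉ D → pc j = ∅)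

theorem Main.start (hM : 0 ≤ M) :
    Main (υ := υ) cl t s M ∅ univ (fun _ => True) := by
  refine ⟨fun _ => ∅, fun _ => ∅, fun _ => 0, fun _ => none, ?_, by simp, trivial, by simp, by simp⟩
  constructor <;> simp [hM]

theorem Main.finish {F : Finset υ} {Q} (h : Main cl t s M univ F Q) :
    Nonempty (PSchedule υ cl t s M) := by
  obtain ⟨pc, su, e, o, G, _, _, h1, _⟩ := h
  exact ⟨⟨pc, su,
    fun j p hp => ⟨(G.pb j p hp).1, (G.pb j p hp).2.1, (G.pb j p hp).2.2.trans (G.eb _).2⟩,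
    G.np, fun j => h1 j (mem_univ _),
    fun u q hq => ⟨(G.sb u q hq).1, (G.sb u q hq).2.trans (G.eb _).2⟩,
    G.pd, G.sd, G.ps, G.bf⟩⟩

/-- Add one class, starting on machine `u` with load at most `x`, using free machines `F`; the
other free machines `F'` are untouched. -/
theorem Main.addClass (hs : ∀ i, 0 < s i) (ht : ∀ j, 0 < t j) {D : Finset γ} {F R : Finset υ}
    {u : υ} {i : γ} {B x : ℝ} (h : Main cl t s M D (F ∪ R) (fun e => e u ≤ x))
    (hu : u ∉ F) (huR : u ∉ R) (hFR : Disjoint F R) (hi : i ∉ D)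
    (hB : s i ≤ B) (hBM : B < M) (hS : ∀ j, cl j = i → t j ≤ M - B)
    (hcap : s i + ∑ j ∈ univ.filter (fun j => cl j = i), t j ≤ (M - x) + F.card * (M - B)) :
    ∃ u' F' x', F' ⊆ F ∧ u' ∈ insert u F ∧ u' ∉ F' ∧
      (M - x) + F.card * (M - B) - (s i + ∑ j ∈ univ.filter (fun j => cl j = i), t j)
        ≤ (M - x') + F'.card * (M - B) ∧
      Main cl t s M (insert i D) (F' ∪ R) (fun e => e u' ≤ x') := by
  obtain ⟨pc, su, e, o, G, hf, hx, hd, he⟩ := h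
  have C : Cur cl s M pc e o u F := ⟨⟨su, G⟩, hu, fun v hv => hf v (mem_union_left _ hv)⟩
  obtain ⟨pc', e', o', u', F', ⟨⟨su', G'⟩, hu', hf'⟩, h1, h2, h3, h4, h5, h6⟩ :=
    C.addClass hs ht hB hBM (i := i) (fun j hj => ⟨hS j hj, he j (by rwa [hj])⟩) (by linarith)
  refine ⟨u', F', e' u', h2, h1, hu', by linarith, pc', su', e', o', G', ?_, le_rfl, ?_, ?_⟩
  · intro v hv
    rcases mem_union.1 hv with hv | hv
    · exact hf' v hv
    · rw [h4 v, hf v (mem_union_right _ hv)]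
      rw [mem_insert, not_or]
      exact ⟨by rintro rfl; exact huR hv, fun h => disjoint_left.1 hFR h hv⟩
  · intro j hj
    by_cases hji : cl j = i
    · exact h6 j hji
    · rw [h5 j hji]
      exact hd j (by simpa [hji] using hj)
  · intro j hj
    rw [mem_insert, not_or] at hj
    rw [h5 j hj.1, he j hj.2]

theorem Main.mono {D : Finset γ} {F F' : Finset υ} {Q Q' : (υ → ℝ) → Prop}
    (h : Main cl t s M D F Q) (hF : F' ⊆ F)
    (hQ : ∀ e : υ → ℝ, (∀ v ∈ F, e v = 0) → Q e → Q' e) : Main cl t s M D F' Q' := by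
  obtain ⟨pc, su, e, o, G, hf, hx, hd, he⟩ := h
  exact ⟨pc, su, e, o, G, fun v hv => hf v (hF hv), hQ e hf hx, hd, he⟩

theorem Main.addOne (hs : ∀ i, 0 < s i) (ht : ∀ j, 0 < t j) {D : Finset γ} {R : Finset υ}
    {u : υ} {i : γ} {B x : ℝ} (h : Main cl t s M D R (fun e => e u ≤ x))
    (huR : u ∉ R) (hi : i ∉ D)
    (hB : s i ≤ B) (hBM : B < M) (hS : ∀ j, cl j = i → t j ≤ M - B)
    (hcap : s i + ∑ j ∈ univ.filter (fun j => cl j = i), t j ≤ M - x) :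
    Main cl t s M (insert i D) R
      (fun e => e u ≤ x + (s i + ∑ j ∈ univ.filter (fun j => cl j = i), t j)) := by
  obtain ⟨u', F', x', h1, h2, h3, h4, h5⟩ := Main.addClass hs ht (F := ∅) (R := R) (by simpa using h)
    (by simp) huR (by simp) hi hB hBM hS (by simpa using hcap)
  have hF' : F' = ∅ := subset_empty.1 h1
  subst hF'
  simp at h2 h4
  subst h2
  exact h5.mono (by simp) (fun e _ he => by linarith)

theorem Main.addMany (hs : ∀ i, 0 < s i) (ht : ∀ j, 0 < t j) {D : Finset γ} {F : Finset υ}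
    {u : υ} {B x : ℝ} (h : Main cl t s M D F (fun e => e u ≤ x))
    (hu : u ∉ F) (A : Finset γ) (hDA : Disjoint D A)
    (hB : ∀ i ∈ A, s i ≤ B) (hBM : B < M) (hS : ∀ j, cl j ∈ A → t j ≤ M - B)
    (hcap : ∑ i ∈ A, (s i + ∑ j ∈ univ.filter (fun j => cl j = i), t j)
      ≤ (M - x) + F.card * (M - B)) :
    ∃ (u' : υ) (F' : Finset υ) (x' : ℝ), u' ∉ F' ∧
      (M - x) + F.card * (M - B) -
        ∑ i ∈ A, (s i + ∑ j ∈ univ.filter (fun j => cl j = i), t j)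
        ≤ (M - x') + F'.card * (M - B) ∧
      Main cl t s M (D ∪ A) F' (fun e => e u' ≤ x') := by
  induction A using Finset.induction_on with
  | empty => exact ⟨u, F, x, hu, by simp, by simpa using h⟩
  | insert i A hiA ih =>
    rw [sum_insert hiA] at hcap
    have hsum0 : 0 ≤ ∑ j ∈ univ.filter (fun j => cl j = i), t j :=
      sum_nonneg fun j _ => (ht j).le
    have hsi := hs i
    rw [disjoint_insert_right] at hDA
    obtain ⟨u1, F1, x1, h1, h2, h3⟩ := ih hDA.2 (fun k hk => hB k (mem_insert_of_mem hk))
      (fun j hj => hS j (mem_insert_of_mem hj)) (by linarith)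
    obtain ⟨u', F', x', g1, g2, g3, g4, g5⟩ := Main.addClass hs ht (F := F1) (R := ∅) (i := i)
      (by simpa using h3) h1 (by simp) (by simp) (by simp [hDA.1, hiA])
      (hB i (mem_insert_self _ _)) hBM (fun j hj => hS j (by simp [hj])) (by linarith)
    refine ⟨u', F', x', g3, ?_, ?_⟩
    · rw [sum_insert hiA]; linarith
    · rw [union_insert]; simpa using g5

end helpers

/-- Theorem 4.3 (ii), 3/2-dual approximation for nice preemptive instances: if
`s_i + t_j ≤ T` for all jobs, the instance is nice for `T` (i.e. `I_exp^0 = ∅`),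
`m·T ≥ L_nice` and `m ≥ m_nice`, then there is a feasible preemptive schedule with
makespan at most `(3/2)·T`. -/
theorem pmtn_nice_dual_approximation {υ γ ι : Type*} [Fintype υ] [Fintype γ] [Fintype ι]
    (cl : ι → γ) (t : ι → ℝ) (s : γ → ℝ)
    (ht : ∀ j, 0 < t j) (hs : ∀ i, 0 < s i)
    (hcl : ∀ i : γ, ∃ j, cl j = i)
    (T : ℝ) (hT : 0 < T)
    (hst : ∀ j : ι, s (cl j) + t j ≤ T)
    (P : γ → ℝ) (hP : ∀ i, P i = ∑ j ∈ univ.filter (fun j => cl j = i), t j)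
    (Iexpp Iexp0 Iexpm Ichp : Finset γ)
    (hIexpp : Iexpp = univ.filter (fun i => T / 2 < s i ∧ T ≤ s i + P i))
    (hIexp0 : Iexp0 = univ.filter (fun i =>
      T / 2 < s i ∧ 3 / 4 * T < s i + P i ∧ s i + P i < T))
    (hIexpm : Iexpm = univ.filter (fun i => T / 2 < s i ∧ s i + P i ≤ 3 / 4 * T))
    (hIchp : Ichp = univ.filter (fun i => s i ≤ T / 2))
    (α' : γ → ℤ) (hα' : ∀ i, α' i = ⌊P i / (T - s i)⌋)
    (hnice : Iexp0 = ∅)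
    (hL : (∑ j, t j) + (∑ i ∈ Iexpp, (α' i : ℝ) * s i) + (∑ i ∈ Iexpm ∪ Ichp, s i)
      ≤ (Fintype.card υ : ℝ) * T)
    (hm : (((Iexpm.card + 1) / 2 : ℕ) : ℤ) + (∑ i ∈ Iexpp, α' i)
      ≤ (Fintype.card υ : ℤ)) :
    Nonempty (PSchedule υ cl t s (3 / 2 * T)) := by
  have hsT : ∀ i, s i < T := by
    intro i
    obtain ⟨j, rfl⟩ := hcl i
    linarith [hst j, ht j]
  have hPn : ∀ i, 0 ≤ P i := fun i => by rw [hP i]; exact sum_nonneg fun j _ => (ht j).le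
  have htB : ∀ i j, cl j = i → t j ≤ 3 / 2 * T - (T / 2 + s i) := by
    rintro i j rfl; linarith [hst j]
  have hmp : ∀ i ∈ Iexpp, T / 2 < s i ∧ T ≤ s i + P i := by
    intro i hi; rw [hIexpp] at hi; exact (mem_filter.1 hi).2
  have hmm : ∀ i ∈ Iexpm, T / 2 < s i ∧ s i + P i ≤ 3 / 4 * T := by
    intro i hi; rw [hIexpm] at hi; exact (mem_filter.1 hi).2
  have hmc : ∀ i ∈ Ichp, s i ≤ T / 2 := by
    intro i hi; rw [hIchp] at hi; exact (mem_filter.1 hi).2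
  have hpm : Disjoint Iexpp Iexpm := by
    rw [disjoint_left]; intro i h1 h2
    linarith [(hmp i h1).2, (hmm i h2).2]
  have hpc : Disjoint Iexpp Ichp := by
    rw [disjoint_left]; intro i h1 h2
    linarith [(hmp i h1).1, (hmc i h2)]
  have hmc' : Disjoint Iexpm Ichp := by
    rw [disjoint_left]; intro i h1 h2
    linarith [(hmm i h1).1, (hmc i h2)]
  have huniv : Iexpp ∪ Iexpm ∪ Ichp = univ := by
    ext i
    simp only [mem_union, mem_univ, iff_true]
    have h0 : i ∉ Iexp0 := by rw [hnice]; simp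
    rw [hIexp0] at h0
    rw [hIexpp, hIexpm, hIchp]
    simp only [mem_filter, mem_univ, true_and] at h0 ⊢
    by_contra hcon
    push Not at hcon
    obtain ⟨⟨c1, c2⟩, c3⟩ := hcon
    exact h0 ⟨c3, c2 c3, c1 c3⟩
  have hα1 : ∀ i ∈ Iexpp, 1 ≤ α' i := by
    intro i hi
    rw [hα' i, Int.le_floor]
    have := hsT i
    rw [le_div_iff₀ (by linarith)]
    push_cast
    linarith [(hmp i hi).2]
  have hαu : ∀ i, P i < (α' i + 1) * (T - s i) := by
    intro i
    have h1 := hsT i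
    have := Int.lt_floor_add_one (P i / (T - s i))
    rw [← hα' i, div_lt_iff₀ (by linarith)] at this
    exact this
  have hαl : ∀ i, α' i * (T - s i) ≤ P i := by
    intro i
    have h1 := hsT i
    have := Int.floor_le (P i / (T - s i))
    rw [← hα' i, le_div_iff₀ (by linarith)] at this
    exact this
  -- step A
  have hA : ∀ A : Finset γ, A ⊆ Iexpp → ∃ F : Finset υ,
      Main cl t s (3 / 2 * T) A F (fun _ => True) ∧
      (F.card : ℤ) + ∑ i ∈ A, α' i = Fintype.card υ := by
    intro A
    induction A using Finset.induction_on with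
    | empty => intro _; exact ⟨univ, Main.start (by linarith), by simp⟩
    | insert i A hiA ih =>
      intro hsub
      obtain ⟨F, hF, hcard⟩ := ih (fun k hk => hsub (mem_insert_of_mem hk))
      have hi := hsub (mem_insert_self i A)
      have hle : ∑ k ∈ insert i A, α' k ≤ ∑ k ∈ Iexpp, α' k :=
        sum_le_sum_of_subset_of_nonneg hsub (fun k hk _ => by linarith [hα1 k hk])
      rw [sum_insert hiA] at hle ⊢
      have h1 := hα1 i hi
      obtain ⟨n, hn⟩ := Int.eq_ofNat_of_zero_le (by linarith : 0 ≤ α' i - 1)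
      obtain ⟨G, hGF, hG⟩ := exists_subset_card_eq (s := F) (n := n + 1) (by omega)
      obtain ⟨u, huG⟩ : G.Nonempty := card_pos.1 (by omega)
      have hun : G.erase u ∪ F \ G ⊆ F :=
        union_subset ((erase_subset _ _).trans hGF) sdiff_subset
      have hM1 : Main cl t s (3 / 2 * T) A (G.erase u ∪ F \ G) (fun e => e u ≤ 0) :=
        hF.mono hun (fun e he _ => (he u (hGF huG)).le)
      have hcn : (G.erase u).card = n := by rw [card_erase_of_mem huG, hG]; simp
      have hαn : (α' i : ℝ) = n + 1 := by
        have : α' i = n + 1 := by linarith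
        rw [this]; push_cast; rfl
      obtain ⟨u', F', x', g1, g2, g3, g4, g5⟩ := Main.addClass hs ht (i := i) (B := T / 2 + s i) hM1
        (by simp) (by simp [huG])
        (disjoint_left.2 fun a ha hb => (mem_sdiff.1 hb).2 (mem_of_mem_erase ha)) hiA
        (by linarith) (by linarith [hsT i]) (htB i) (by
          rw [← hP i, hcn]
          have h2 := hαu i
          rw [hαn] at h2
          nlinarith [(hmp i hi).1])
      refine ⟨F \ G, g5.mono subset_union_right (fun _ _ _ => trivial), ?_⟩
      have : (F \ G).card + G.card = F.card := card_sdiff_add_card_eq_card hGF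
      push_cast at *
      omega
  obtain ⟨F0, hF0, hcard0⟩ := hA Iexpp Subset.rfl
  have hnat : F0.card ≥ (Iexpm.card + 1) / 2 := by omega
  -- step B
  have hB : ∀ n : ℕ, ∀ A : Finset γ, A ⊆ Iexpm → A.card = 2 * n → ∃ F : Finset υ,
      Main cl t s (3 / 2 * T) (Iexpp ∪ A) F (fun _ => True) ∧ F.card + n = F0.card := by
    intro n
    induction n with
    | zero =>
      intro A _ hc
      have : A = ∅ := card_eq_zero.1 (by simpa using hc)
      subst this
      exact ⟨F0, by simpa using hF0, by simp⟩
    | succ n ih =>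
      intro A hsub hc
      obtain ⟨i, hi⟩ : A.Nonempty := card_pos.1 (by omega)
      have hc1 : (A.erase i).card = 2 * n + 1 := by rw [card_erase_of_mem hi]; omega
      obtain ⟨k, hk⟩ : (A.erase i).Nonempty := card_pos.1 (by omega)
      have hc2 : ((A.erase i).erase k).card = 2 * n := by rw [card_erase_of_mem hk]; omega
      obtain ⟨F, hF, hFc⟩ := ih ((A.erase i).erase k)
        ((erase_subset _ _).trans ((erase_subset _ _).trans hsub)) hc2
      have hle := card_le_card hsub
      obtain ⟨u, hu⟩ : F.Nonempty := card_pos.1 (by omega)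
      have hiI := hsub hi
      have hkI := hsub (mem_of_mem_erase hk)
      have hki : k ≠ i := ne_of_mem_erase hk
      have h0 : Main cl t s (3 / 2 * T) (Iexpp ∪ (A.erase i).erase k) (F.erase u)
          (fun e => e u ≤ 0) := hF.mono (erase_subset _ _) (fun e he _ => (he u hu).le)
      have h1 := Main.addOne hs ht (i := k) (B := T / 2 + s k) h0 (by simp)
        (by simp [disjoint_right.1 hpm hkI]) (by linarith) (by linarith [hsT k]) (htB k)
        (by rw [← hP k]; linarith [(hmm k hkI).2])
      have h2 := Main.addOne hs ht (i := i) (B := T / 2 + s i) h1 (by simp)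
        (by simp [disjoint_right.1 hpm hiI, hki.symm])
        (by linarith) (by linarith [hsT i]) (htB i)
        (by rw [← hP i, ← hP k]; linarith [(hmm i hiI).2, (hmm k hkI).2])
      refine ⟨F.erase u, ?_, ?_⟩
      · have : insert i (insert k (Iexpp ∪ (A.erase i).erase k)) = Iexpp ∪ A := by
          rw [← union_insert, ← union_insert, insert_erase hk, insert_erase hi]
        rw [this] at h2
        exact h2.mono Subset.rfl (fun _ _ _ => trivial)
      · rw [card_erase_of_mem hu]
        have := card_pos.2 ⟨u, hu⟩
        omega
  -- load accounting
  have hsumP : ∀ A : Finset γ, ∑ i ∈ A, (s i + ∑ j ∈ univ.filter (fun j => cl j = i), t j)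
      = ∑ i ∈ A, (s i + P i) := fun A => sum_congr rfl (fun i _ => by rw [hP i])
  have htot : ∑ j, t j = ∑ i ∈ Iexpp, P i + ∑ i ∈ Iexpm, P i + ∑ i ∈ Ichp, P i := by
    rw [← sum_union hpm, ← sum_union (by rw [disjoint_union_left]; exact ⟨hpc, hmc'⟩), huniv,
      ← sum_fiberwise (s := univ) (g := cl) (f := t)]
    exact sum_congr rfl (fun i _ => (hP i).symm)
  rw [sum_union hmc'] at hL
  have hplus : (∑ i ∈ Iexpp, (α' i : ℝ)) * T ≤ ∑ i ∈ Iexpp, P i + ∑ i ∈ Iexpp, (α' i : ℝ) * s i := by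
    rw [sum_mul, ← sum_add_distrib]
    exact sum_le_sum (fun i _ => by nlinarith [hαl i])
  have hcardR : (F0.card : ℝ) + ∑ i ∈ Iexpp, (α' i : ℝ) = Fintype.card υ := by
    exact_mod_cast hcard0
  have hrem : ∑ i ∈ Iexpm, (s i + P i) + ∑ i ∈ Ichp, (s i + P i) ≤ F0.card * T := by
    rw [sum_add_distrib, sum_add_distrib]
    rw [← hcardR] at hL
    nlinarith
  have hmge : ∀ A : Finset γ, A ⊆ Iexpm → A.card * (T / 2) ≤ ∑ i ∈ A, (s i + P i) := by
    intro A hAs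
    rw [← nsmul_eq_mul]
    exact card_nsmul_le_sum _ _ _ (fun i hi => by linarith [(hmm i (hAs hi)).1, hPn i])
  have htc : ∀ j, cl j ∈ Ichp → t j ≤ 3 / 2 * T - T / 2 := fun j _ => by
    linarith [hst j, hs (cl j)]
  have hdisj : Disjoint (Iexpp ∪ Iexpm) Ichp := by
    rw [disjoint_union_left]; exact ⟨hpc, hmc'⟩
  rcases Nat.even_or_odd' Iexpm.card with ⟨n, hn | hn⟩
  · obtain ⟨F, hF, hFc⟩ := hB n Iexpm Subset.rfl hn
    have h1 := hmge Iexpm Subset.rfl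
    rw [hn] at h1
    have hFc' : (F.card : ℝ) + n = F0.card := by exact_mod_cast hFc
    rw [← hFc'] at hrem
    push_cast at h1
    have hch : ∑ i ∈ Ichp, (s i + P i) ≤ F.card * T := by nlinarith
    rcases F.eq_empty_or_nonempty with hFe | ⟨u, hu⟩
    · have hce : Ichp = ∅ := by
        by_contra hne
        have : 0 < ∑ i ∈ Ichp, (s i + P i) :=
          sum_pos (fun i _ => by linarith [hs i, hPn i]) (nonempty_iff_ne_empty.2 hne)
        rw [hFe] at hch
        simp at hch
        linarith
      rw [hce, union_empty] at huniv
      rw [huniv] at hF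
      exact hF.finish
    · have hcF : ((F.erase u).card : ℝ) + 1 = F.card := by
        exact_mod_cast card_erase_add_one hu
      obtain ⟨u', F', x', g1, g2, g3⟩ := Main.addMany hs ht (u := u) (x := 0) (B := T / 2)
        (hF.mono (F' := F.erase u) (Q' := fun e => e u ≤ 0) (erase_subset _ _)
          (fun e he _ => (he u hu).le)) (by simp) Ichp hdisj hmc (by linarith) htc
        (by rw [hsumP]; rw [← hcF] at hch; linarith)
      rw [huniv] at g3
      exact g3.finish
  · obtain ⟨i, hi⟩ : Iexpm.Nonempty := card_pos.1 (by omega)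
    have hce : (Iexpm.erase i).card = 2 * n := by rw [card_erase_of_mem hi]; omega
    obtain ⟨F, hF, hFc⟩ := hB n (Iexpm.erase i) (erase_subset _ _) hce
    obtain ⟨u, hu⟩ : F.Nonempty := card_pos.1 (by omega)
    have h1 := hmge (Iexpm.erase i) (erase_subset _ _)
    rw [hce] at h1
    rw [← add_sum_erase _ _ hi] at hrem
    have hFc' : (F.card : ℝ) + n = F0.card := by exact_mod_cast hFc
    rw [← hFc'] at hrem
    push_cast at h1
    have hcF : ((F.erase u).card : ℝ) + 1 = F.card := by
      exact_mod_cast card_erase_add_one hu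
    have hch : (s i + P i) + ∑ i ∈ Ichp, (s i + P i) ≤ F.card * T := by nlinarith
    have h0 : Main cl t s (3 / 2 * T) (Iexpp ∪ Iexpm.erase i) (F.erase u)
        (fun e => e u ≤ 0) := hF.mono (erase_subset _ _) (fun e he _ => (he u hu).le)
    have h2 := Main.addOne hs ht (i := i) (B := T / 2 + s i) h0 (by simp)
      (by simp [disjoint_right.1 hpm hi]) (by linarith) (by linarith [hsT i]) (htB i)
      (by rw [← hP i]; linarith [(hmm i hi).2])
    rw [← union_insert, insert_erase hi] at h2
    obtain ⟨u', F', x', g1, g2, g3⟩ := Main.addMany hs ht (B := T / 2) h2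
      (by simp) Ichp hdisj hmc (by linarith) htc
      (by rw [hsumP, ← hP i]; rw [← hcF] at hch; linarith)
    rw [huniv] at g3
    exact g3.finish
end

section
/- (Lemma B.1, soundness of large machines.) Let T > 0 and suppose there exists a feasible preemptive schedule with makespan at most T. Let I_exp^0 = { i : s_i > T/2 and (3/4)T < s_i + P(C_i) < T }. Then there exists a feasible preemptive schedule σ with makespan at most (3/2)·T such that for every class i ∈ I_exp^0 all job pieces of jobs of C_i are scheduled on a single machine u_i, the machines u_i for distinct classes of I_exp^0 are distinct, and the load of u_i (the total length of all job-piece and setup intervals on u_i) satisfies s_i + P(C_i) ≤ load(u_i) ≤ T. -/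
open Classical Finset

theorem aux_pack {κ : Type*} (K : Finset κ) (x y : κ → ℝ) (lo : ℝ) :
    ∀ hi : ℝ, lo ≤ hi → (∀ k ∈ K, lo ≤ x k ∧ x k < y k ∧ y k ≤ hi) →
    (∀ k ∈ K, ∀ k' ∈ K, k ≠ k' → y k ≤ x k' ∨ y k' ≤ x k) →
    ∑ k ∈ K, (y k - x k) ≤ hi - lo := by
  induction K using Finset.induction_on_max_value x with
  | empty => intro hi h _ _; simpa using h
  | insert a S ha hmax ih =>
    intro hi h hb hd
    rw [Finset.sum_insert ha]
    have h1 := hb a (Finset.mem_insert_self _ _)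
    have := ih (x a) h1.1 (fun k hk => by
      have hk' := hb k (Finset.mem_insert_of_mem hk)
      refine ⟨hk'.1, hk'.2.1, ?_⟩
      have hne : k ≠ a := fun e => ha (e ▸ hk)
      rcases hd k (Finset.mem_insert_of_mem hk) a (Finset.mem_insert_self _ _) hne with h2 | h2
      · exact h2
      · have := hmax k hk
        linarith)
      (fun k hk k' hk' => hd k (Finset.mem_insert_of_mem hk) k' (Finset.mem_insert_of_mem hk'))
    linarith

theorem aux_layout {κ : Type*} (K : Finset κ) (l : κ → ℝ) (hl : ∀ k, 0 ≤ l k) :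
    ∃ x : κ → ℝ, (∀ k ∈ K, 0 ≤ x k ∧ x k + l k ≤ ∑ k ∈ K, l k) ∧
      ∀ k ∈ K, ∀ k' ∈ K, k ≠ k' → x k + l k ≤ x k' ∨ x k' + l k' ≤ x k := by
  induction K using Finset.induction_on with
  | empty => exact ⟨fun _ => 0, by simp, by simp⟩
  | insert a S ha ih =>
    obtain ⟨x, hx, hd⟩ := ih
    have hS : 0 ≤ ∑ k ∈ S, l k := Finset.sum_nonneg (fun k _ => hl k)
    refine ⟨Function.update x a (∑ k ∈ S, l k), ?_, ?_⟩
    · intro k hk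
      rw [Finset.sum_insert ha]
      by_cases e : k = a
      · subst e; simp only [Function.update_self]; exact ⟨hS, by linarith⟩
      · have := hx k (Finset.mem_of_mem_insert_of_ne hk e)
        have := hl a
        simp only [Function.update_of_ne e]
        constructor <;> linarith
    · intro k hk k' hk' hne
      by_cases e : k = a
      · subst e
        have e' : k' ≠ k := hne.symm
        have := hx k' (Finset.mem_of_mem_insert_of_ne hk' e')
        simp only [Function.update_self, Function.update_of_ne e']
        right; linarith
      · by_cases e' : k' = a
        · subst e'
          have := hx k (Finset.mem_of_mem_insert_of_ne hk e)
          simp only [Function.update_self, Function.update_of_ne e]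
          left; linarith
        · simp only [Function.update_of_ne e', Function.update_of_ne e]
          exact hd k (Finset.mem_of_mem_insert_of_ne hk e) k'
            (Finset.mem_of_mem_insert_of_ne hk' e') hne

theorem aux_joblayout {γ ι : Type*} [Fintype ι] (cl : ι → γ) (r : ι → ℝ) (hr : ∀ j, 0 ≤ r j) :
    ∃ y : ι → ℝ, (∀ j, 0 ≤ y j ∧ y j + r j ≤ ∑ k ∈ univ.filter (fun k => cl k = cl j), r k) ∧
      ∀ j j', cl j = cl j' → j ≠ j' → y j + r j ≤ y j' ∨ y j' + r j' ≤ y j := by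
  choose x hx hd using fun c : γ => aux_layout (univ.filter (fun k => cl k = c)) r hr
  refine ⟨fun j => x (cl j) j, fun j => hx (cl j) j (by simp), ?_⟩
  intro j j' e hne
  have := hd (cl j) j (by simp) j' (by simp [e]) hne
  simpa [e] using this

theorem aux_pairing {α : Type*} : ∀ (n : ℕ) (M : Finset α), M.card = n →
    ∃ H ⊆ M, ∃ f : α → α, ∃ W ⊆ H, (∀ u ∈ M \ H, f u ∈ H) ∧
      (∀ u ∈ M \ H, ∀ v ∈ M \ H, f u = f v → u = v) ∧ (∀ u ∈ M \ H, f u ∉ W) ∧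
      W.card ≤ 1 ∧ H.card = (M \ H).card + W.card := by
  intro n
  induction n using Nat.strong_induction_on with
  | _ n ih =>
    intro M hM
    by_cases h2 : n < 2
    · refine ⟨M, subset_rfl, id, M, subset_rfl, by simp, by simp, by simp, by omega, by simp⟩
    · have : 1 < M.card := by omega
      obtain ⟨a, ha, b, hb, hab⟩ := Finset.one_lt_card.1 this
      have hbM : b ∈ M.erase a := Finset.mem_erase.2 ⟨hab.symm, hb⟩
      have hc : ((M.erase a).erase b).card = n - 2 := by
        rw [Finset.card_erase_of_mem hbM, Finset.card_erase_of_mem ha]; omega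
      obtain ⟨H, hH, f, W, hW, h1, h3, h4, h5, h6⟩ := ih (n - 2) (by omega) _ hc
      have haH : a ∉ H := fun h => by simpa using hH h
      have hbH : b ∉ H := fun h => by simpa using hH h
      have hsd : M \ insert a H = insert b (((M.erase a).erase b) \ H) := by
        ext u
        simp only [Finset.mem_sdiff, Finset.mem_insert, Finset.mem_erase]
        constructor
        · rintro ⟨hu, hn⟩
          push Not at hn
          by_cases e : u = b
          · exact Or.inl e
          · exact Or.inr ⟨⟨e, hn.1, hu⟩, hn.2⟩
        · rintro (e | ⟨⟨e1, e2, hu⟩, hn⟩)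
          · subst e; exact ⟨hb, by push Not; exact ⟨hab.symm, hbH⟩⟩
          · exact ⟨hu, by push Not; exact ⟨e2, hn⟩⟩
      have hbn : b ∉ ((M.erase a).erase b) \ H := by simp
      have key : ∀ u ∈ ((M.erase a).erase b) \ H, u ≠ b := fun u hu e => hbn (e ▸ hu)
      refine ⟨insert a H, ?_, Function.update f b a, W, hW.trans (Finset.subset_insert _ _),
        ?_, ?_, ?_, h5, ?_⟩
      · intro u hu
        rcases Finset.mem_insert.1 hu with e | hu
        · exact e ▸ ha
        · have := hH hu
          simp only [Finset.mem_erase] at this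
          exact this.2.2
      · rw [hsd]
        intro u hu
        rcases Finset.mem_insert.1 hu with e | hu
        · subst e; simp
        · rw [Function.update_of_ne (key u hu)]
          exact Finset.mem_insert_of_mem (h1 u hu)
      · rw [hsd]
        intro u hu v hv e
        rcases Finset.mem_insert.1 hu with eu | hu
        · rcases Finset.mem_insert.1 hv with ev | hv
          · rw [eu, ev]
          · subst eu
            rw [Function.update_self, Function.update_of_ne (key v hv)] at e
            exact absurd (e ▸ h1 v hv) haH
        · rcases Finset.mem_insert.1 hv with ev | hv
          · subst ev
            rw [Function.update_self, Function.update_of_ne (key u hu)] at e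
            exact absurd (e ▸ h1 u hu) haH
          · rw [Function.update_of_ne (key v hv), Function.update_of_ne (key u hu)] at e
            exact h3 u hu v hv e
      · rw [hsd]
        intro u hu
        rcases Finset.mem_insert.1 hu with e | hu
        · subst e; rw [Function.update_self]; exact fun h => haH (hW h)
        · rw [Function.update_of_ne (key u hu)]; exact h4 u hu
      · rw [hsd, Finset.card_insert_of_notMem haH, Finset.card_insert_of_notMem hbn, h6]
        omega

/-- Union of two partial schedules. -/
theorem aux_union {υ γ ι : Type*} [Fintype υ] [Fintype γ] [Fintype ι]
    {cl : ι → γ} {r₁ r₂ : ι → ℝ} {s : γ → ℝ} {M : ℝ} (hs : ∀ i, 0 < s i)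
    (σ₁ : PSchedule υ cl r₁ s M) (σ₂ : PSchedule υ cl r₂ s M)
    (r : ι → ℝ) (hr : ∀ j, r j = r₁ j + r₂ j)
    (hpar : ∀ j, ∀ p ∈ σ₁.pieces j, ∀ q ∈ σ₂.pieces j, p.2.2 ≤ q.2.1 ∨ q.2.2 ≤ p.2.1)
    (hcut : ∀ u, ∃ c : ℝ,
      ((∀ j, ∀ p ∈ σ₁.pieces j, p.1 = u → p.2.2 ≤ c) ∧
       (∀ q ∈ σ₁.setups u, q.2 + s q.1 ≤ c) ∧
       (∀ j, ∀ p ∈ σ₂.pieces j, p.1 = u → c ≤ p.2.1) ∧ (∀ q ∈ σ₂.setups u, c ≤ q.2)) ∨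
      ((∀ j, ∀ p ∈ σ₂.pieces j, p.1 = u → p.2.2 ≤ c) ∧
       (∀ q ∈ σ₂.setups u, q.2 + s q.1 ≤ c) ∧
       (∀ j, ∀ p ∈ σ₁.pieces j, p.1 = u → c ≤ p.2.1) ∧ (∀ q ∈ σ₁.setups u, c ≤ q.2))) :
    ∃ σ₃ : PSchedule υ cl r s M, (∀ j p, p ∈ σ₃.pieces j ↔ p ∈ σ₁.pieces j ∨ p ∈ σ₂.pieces j) ∧
      (∀ u q, q ∈ σ₃.setups u ↔ q ∈ σ₁.setups u ∨ q ∈ σ₂.setups u) ∧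
      (∀ u, pLoad σ₃ u = pLoad σ₁ u + pLoad σ₂ u) := by
  have hpp : ∀ j j', ∀ p ∈ σ₁.pieces j, ∀ q ∈ σ₂.pieces j', p.1 = q.1 →
      p.2.2 ≤ q.2.1 ∨ q.2.2 ≤ p.2.1 := by
    intro j j' p hp q hq e
    obtain ⟨c, h | h⟩ := hcut p.1
    · have h1 := h.1 j p hp rfl
      have h2 := h.2.2.1 j' q hq e.symm
      left; linarith
    · have h1 := h.1 j' q hq e.symm
      have h2 := h.2.2.1 j p hp rfl
      right; linarith
  have hqq : ∀ u, ∀ p ∈ σ₁.setups u, ∀ q ∈ σ₂.setups u,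
      p.2 + s p.1 ≤ q.2 ∨ q.2 + s q.1 ≤ p.2 := by
    intro u p hp q hq
    obtain ⟨c, h | h⟩ := hcut u
    · have h1 := h.2.1 p hp
      have h2 := h.2.2.2 q hq
      left; linarith
    · have h1 := h.2.1 q hq
      have h2 := h.2.2.2 p hp
      right; linarith
  have hpdisj : ∀ j, Disjoint (σ₁.pieces j) (σ₂.pieces j) := by
    intro j
    rw [Finset.disjoint_left]
    intro p hp hq
    have h1 := σ₁.pieces_bounds j p hp
    rcases hpar j p hp p hq with h | h <;> linarith
  have hqdisj : ∀ u, Disjoint (σ₁.setups u) (σ₂.setups u) := by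
    intro j
    rw [Finset.disjoint_left]
    intro p hp hq
    have h1 := hs p.1
    rcases hqq j p hp p hq with h | h <;> linarith
  refine ⟨{ pieces := fun j => σ₁.pieces j ∪ σ₂.pieces j
            setups := fun u => σ₁.setups u ∪ σ₂.setups u
            pieces_bounds := ?_, pieces_no_parallel := ?_, pieces_sum := ?_, setup_bounds := ?_,
            machine_pieces_disjoint := ?_, machine_setups_disjoint := ?_,
            machine_piece_setup_disjoint := ?_, setup_before := ?_ }, ?_, ?_, ?_⟩
  · intro j p hp
    rcases Finset.mem_union.1 hp with hp | hp
    · exact σ₁.pieces_bounds j p hp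
    · exact σ₂.pieces_bounds j p hp
  · intro j p hp q hq hne
    rcases Finset.mem_union.1 hp with hp | hp <;> rcases Finset.mem_union.1 hq with hq | hq
    · exact σ₁.pieces_no_parallel j p hp q hq hne
    · exact hpar j p hp q hq
    · exact (hpar j q hq p hp).symm
    · exact σ₂.pieces_no_parallel j p hp q hq hne
  · intro j
    rw [Finset.sum_union (hpdisj j), σ₁.pieces_sum, σ₂.pieces_sum, hr]
  · intro u q hq
    rcases Finset.mem_union.1 hq with hq | hq
    · exact σ₁.setup_bounds u q hq
    · exact σ₂.setup_bounds u q hq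
  · intro j₁ j₂ p hp q hq e hne
    rcases Finset.mem_union.1 hp with hp | hp <;> rcases Finset.mem_union.1 hq with hq | hq
    · exact σ₁.machine_pieces_disjoint j₁ j₂ p hp q hq e hne
    · exact hpp j₁ j₂ p hp q hq e
    · exact (hpp j₂ j₁ q hq p hp e.symm).symm
    · exact σ₂.machine_pieces_disjoint j₁ j₂ p hp q hq e hne
  · intro u p hp q hq hne
    rcases Finset.mem_union.1 hp with hp | hp <;> rcases Finset.mem_union.1 hq with hq | hq
    · exact σ₁.machine_setups_disjoint u p hp q hq hne
    · exact hqq u p hp q hq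
    · exact (hqq u q hq p hp).symm
    · exact σ₂.machine_setups_disjoint u p hp q hq hne
  · intro j p hp q hq
    obtain ⟨c, h | h⟩ := hcut p.1 <;>
    rcases Finset.mem_union.1 hp with hp | hp <;> rcases Finset.mem_union.1 hq with hq | hq
    · exact σ₁.machine_piece_setup_disjoint j p hp q hq
    · have h1 := h.1 j p hp rfl
      have h2 := h.2.2.2 q hq
      left; linarith
    · have h1 := h.2.2.1 j p hp rfl
      have h2 := h.2.1 q hq
      right; linarith
    · exact σ₂.machine_piece_setup_disjoint j p hp q hq
    · exact σ₁.machine_piece_setup_disjoint j p hp q hq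
    · have h1 := h.2.2.1 j p hp rfl
      have h2 := h.2.1 q hq
      right; linarith
    · have h1 := h.1 j p hp rfl
      have h2 := h.2.2.2 q hq
      left; linarith
    · exact σ₂.machine_piece_setup_disjoint j p hp q hq
  · intro j p hp
    rcases Finset.mem_union.1 hp with hp | hp
    · obtain ⟨a, ha, hle, hA, hB⟩ := σ₁.setup_before j p hp
      have hb := σ₁.pieces_bounds j p hp
      have hsj := hs (cl j)
      refine ⟨a, Finset.mem_union_left _ ha, hle, ?_, ?_⟩
      · intro q hq hne
        rcases Finset.mem_union.1 hq with hq | hq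
        · exact hA q hq hne
        · rintro ⟨x1, x2⟩
          obtain ⟨c, h | h⟩ := hcut p.1
          · have h1 := h.1 j p hp rfl
            have h2 := h.2.2.2 q hq
            linarith
          · have h1 := h.2.2.2 _ ha
            have h2 := h.2.1 q hq
            simp only at h1
            linarith
      · intro j' hne q hq e
        rcases Finset.mem_union.1 hq with hq | hq
        · exact hB j' hne q hq e
        · rintro ⟨x1, x2⟩
          obtain ⟨c, h | h⟩ := hcut p.1
          · have h1 := h.1 j p hp rfl
            have h2 := h.2.2.1 j' q hq e
            linarith
          · have h1 := h.2.2.2 _ ha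
            have h2 := h.1 j' q hq e
            simp only at h1
            linarith
    · obtain ⟨a, ha, hle, hA, hB⟩ := σ₂.setup_before j p hp
      have hb := σ₂.pieces_bounds j p hp
      have hsj := hs (cl j)
      refine ⟨a, Finset.mem_union_right _ ha, hle, ?_, ?_⟩
      · intro q hq hne
        rcases Finset.mem_union.1 hq with hq | hq
        · rintro ⟨x1, x2⟩
          obtain ⟨c, h | h⟩ := hcut p.1
          · have h1 := h.2.2.2 _ ha
            have h2 := h.2.1 q hq
            simp only at h1
            linarith
          · have h1 := h.1 j p hp rfl
            have h2 := h.2.2.2 q hq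
            linarith
        · exact hA q hq hne
      · intro j' hne q hq e
        rcases Finset.mem_union.1 hq with hq | hq
        · rintro ⟨x1, x2⟩
          obtain ⟨c, h | h⟩ := hcut p.1
          · have h1 := h.2.2.2 _ ha
            have h2 := h.1 j' q hq e
            simp only at h1
            linarith
          · have h1 := h.1 j p hp rfl
            have h2 := h.2.2.1 j' q hq e
            linarith
        · exact hB j' hne q hq e
  · intro j p; simp
  · intro u q; simp
  · intro u
    simp only [pLoad]
    rw [Finset.sum_union (hqdisj u)]
    have : ∀ j, ∑ p ∈ (σ₁.pieces j ∪ σ₂.pieces j).filter (fun p => p.1 = u), (p.2.2 - p.2.1) =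
        ∑ p ∈ (σ₁.pieces j).filter (fun p => p.1 = u), (p.2.2 - p.2.1) +
        ∑ p ∈ (σ₂.pieces j).filter (fun p => p.1 = u), (p.2.2 - p.2.1) := by
      intro j
      rw [Finset.filter_union, Finset.sum_union]
      exact Finset.disjoint_filter_filter (hpdisj j)
    simp only [this, Finset.sum_add_distrib]
    ring

/-- Whole classes scheduled sequentially in one block each. -/
theorem aux_seq {υ γ ι : Type*} [Fintype υ] [Fintype γ] [Fintype ι]
    (cl : ι → γ) (t : ι → ℝ) (s : γ → ℝ) (M : ℝ) (ht : ∀ j, 0 < t j) (hs : ∀ i, 0 < s i)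
    (P : γ → ℝ) (hP : ∀ i, P i = ∑ j ∈ univ.filter (fun j => cl j = i), t j)
    (Q : Finset γ) (h : γ → υ) (τ : γ → ℝ)
    (hτ : ∀ i ∈ Q, 0 ≤ τ i ∧ τ i + s i + P i ≤ M)
    (hd : ∀ i ∈ Q, ∀ i' ∈ Q, i ≠ i' → h i = h i' →
      τ i + s i + P i ≤ τ i' ∨ τ i' + s i' + P i' ≤ τ i) :
    ∃ σ₁ : PSchedule υ cl (fun j => if cl j ∈ Q then t j else 0) s M,
      (∀ j, ∀ p ∈ σ₁.pieces j, cl j ∈ Q ∧ p.1 = h (cl j) ∧ τ (cl j) ≤ p.2.1 ∧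
        p.2.2 ≤ τ (cl j) + s (cl j) + P (cl j)) ∧
      (∀ u, ∀ q ∈ σ₁.setups u, q.1 ∈ Q ∧ h q.1 = u ∧ q.2 = τ q.1) ∧
      (∀ i ∈ Q, (∀ i' ∈ Q, h i' = h i → i' = i) → pLoad σ₁ (h i) = s i + P i) := by
  obtain ⟨y, hy, hyd⟩ := aux_joblayout cl t (fun j => (ht j).le)
  have hyP : ∀ j, 0 ≤ y j ∧ y j + t j ≤ P (cl j) := fun j => by rw [hP]; exact hy j
  have hP0 : ∀ i, 0 ≤ P i := fun i => by
    rw [hP]; exact Finset.sum_nonneg (fun j _ => (ht j).le)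
  let pc : ι → υ × ℝ × ℝ := fun j =>
    (h (cl j), τ (cl j) + s (cl j) + y j, τ (cl j) + s (cl j) + y j + t j)
  have hmem : ∀ j p, p ∈ (if cl j ∈ Q then ({pc j} : Finset (υ × ℝ × ℝ)) else ∅) ↔
      cl j ∈ Q ∧ p = pc j := by
    intro j p; split_ifs with hq <;> simp [hq]
  have hmem2 : ∀ u q, q ∈ (Q.filter (fun i => h i = u)).image (fun i => (i, τ i)) ↔
      q.1 ∈ Q ∧ h q.1 = u ∧ q.2 = τ q.1 := by
    intro u q
    simp only [Finset.mem_image, Finset.mem_filter]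
    constructor
    · rintro ⟨i, hi, rfl⟩; exact ⟨hi.1, hi.2, rfl⟩
    · rintro ⟨h1, h2, h3⟩; exact ⟨q.1, ⟨h1, h2⟩, by ext <;> simp [h3]⟩
  refine ⟨{ pieces := fun j => if cl j ∈ Q then {pc j} else ∅
            setups := fun u => (Q.filter (fun i => h i = u)).image (fun i => (i, τ i))
            pieces_bounds := ?_, pieces_no_parallel := ?_, pieces_sum := ?_, setup_bounds := ?_,
            machine_pieces_disjoint := ?_, machine_setups_disjoint := ?_,
            machine_piece_setup_disjoint := ?_, setup_before := ?_ }, ?_, ?_, ?_⟩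
  · intro j p hp
    rw [hmem] at hp
    obtain ⟨hq, rfl⟩ := hp
    have h1 := hyP j
    have h2 := hτ _ hq
    have h3 := hs (cl j)
    have h4 := ht j
    simp only [pc]
    refine ⟨?_, ?_, ?_⟩ <;> linarith
  · intro j p hp q hq hne
    rw [hmem] at hp hq
    exact absurd (hp.2.trans hq.2.symm) hne
  · intro j
    split_ifs with hq
    · simp [pc]
    · simp
  · intro u q hq
    rw [hmem2] at hq
    have h2 := hτ _ hq.1
    have := hP0 q.1
    rw [hq.2.2]
    constructor <;> linarith
  · intro j₁ j₂ p hp q hq e hne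
    rw [hmem] at hp hq
    obtain ⟨hq1, rfl⟩ := hp
    obtain ⟨hq2, rfl⟩ := hq
    simp only [pc] at e ⊢
    have h1 := hyP j₁
    have h2 := hyP j₂
    have s1 := hs (cl j₁)
    have s2 := hs (cl j₂)
    by_cases ec : cl j₁ = cl j₂
    · have hj : j₁ ≠ j₂ := by
        rintro rfl
        simp at hne
      rw [ec]
      rcases hyd j₁ j₂ ec hj with h | h
      · left; linarith
      · right; linarith
    · rcases hd _ hq1 _ hq2 ec e with h | h
      · left; linarith
      · right; linarith
  · intro u p hp q hq hne
    rw [hmem2] at hp hq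
    have ec : p.1 ≠ q.1 := fun ec => hne (by ext <;> simp [ec, hp.2.2, hq.2.2])
    have := hP0 p.1
    have := hP0 q.1
    rw [hp.2.2, hq.2.2]
    rcases hd _ hp.1 _ hq.1 ec (hp.2.1.trans hq.2.1.symm) with h | h
    · left; linarith
    · right; linarith
  · intro j p hp q hq
    rw [hmem] at hp
    rw [hmem2] at hq
    obtain ⟨hq1, rfl⟩ := hp
    have h1 := hyP j
    have s1 := hs (cl j)
    have := hP0 q.1
    simp only [pc] at hq ⊢
    rw [hq.2.2]
    by_cases ec : cl j = q.1
    · right; rw [← ec]; linarith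
    · rcases hd _ hq1 _ hq.1 ec hq.2.1.symm with h | h
      · left; linarith
      · right; linarith
  · intro j p hp
    rw [hmem] at hp
    obtain ⟨hq1, rfl⟩ := hp
    have h1 := hyP j
    have s1 := hs (cl j)
    have t1 := ht j
    refine ⟨τ (cl j), ?_, ?_, ?_, ?_⟩
    · rw [hmem2]; exact ⟨hq1, rfl, rfl⟩
    · simp only [pc]; linarith
    · intro q hq hne
      rw [hmem2] at hq
      simp only [pc] at hq ⊢
      rw [hq.2.2]
      have := hP0 q.1
      have := hs q.1
      rcases hd _ hq1 _ hq.1 (Ne.symm hne) hq.2.1.symm with h | h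
      · rintro ⟨h3, h4⟩; linarith
      · rintro ⟨h3, h4⟩; linarith
    · intro j' hne q hq e
      rw [hmem] at hq
      obtain ⟨hq2, rfl⟩ := hq
      have h2 := hyP j'
      have s2 := hs (cl j')
      simp only [pc] at e ⊢
      rcases hd _ hq1 _ hq2 (Ne.symm hne) e.symm with h | h
      · rintro ⟨h3, h4⟩; linarith
      · rintro ⟨h3, h4⟩; linarith
  · intro j p hp
    rw [hmem] at hp
    obtain ⟨hq1, rfl⟩ := hp
    have h1 := hyP j
    have s1 := hs (cl j)
    refine ⟨hq1, rfl, ?_, ?_⟩ <;> simp only [pc] <;> linarith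
  · intro u q hq
    rw [hmem2] at hq
    exact hq
  · intro i hi huniq
    simp only [pLoad]
    have e1 : (Q.filter (fun i' => h i' = h i)) = {i} := by
      ext i'
      simp only [Finset.mem_filter, Finset.mem_singleton]
      constructor
      · rintro ⟨h1, h2⟩; exact huniq i' h1 h2
      · rintro rfl; exact ⟨hi, rfl⟩
    rw [e1, Finset.image_singleton, Finset.sum_singleton, hP i, Finset.sum_filter, add_comm]
    congr 1
    apply Finset.sum_congr rfl
    intro j _
    by_cases ec : cl j = i
    · subst ec
      simp [hi, pc, Finset.filter_singleton]
    · rw [if_neg ec]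
      apply Finset.sum_eq_zero
      intro p hp
      rw [Finset.mem_filter, hmem] at hp
      obtain ⟨⟨h1, rfl⟩, h2⟩ := hp
      exact absurd (huniq _ h1 h2) ec


/-- Expensive classes with `s i + P i ≥ T`: host machines receive the content of at most two
machines, the second one delayed by `T / 2`. -/
theorem aux_high {υ γ ι : Type*} [Fintype υ] [Fintype γ] [Fintype ι]
    {cl : ι → γ} {t : ι → ℝ} {s : γ → ℝ} {T : ℝ} (hT : 0 < T) (hs : ∀ i, 0 < s i)
    (σ : PSchedule υ cl t s T) (Hi : Finset γ) (hexp : ∀ i ∈ Hi, T / 2 < s i)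
    (hsT : ∀ i ∈ Hi, s i ≤ T)
    (H : γ → Finset υ) (host : γ → υ → υ) (sh : γ → υ → ℝ)
    (h1 : ∀ i ∈ Hi, ∀ u, (∃ a, (i, a) ∈ σ.setups u) → host i u ∈ H i)
    (h2 : ∀ i ∈ Hi, ∀ u, sh i u = 0 ∨ sh i u = T / 2)
    (h3 : ∀ i ∈ Hi, ∀ u, (∃ a, (i, a) ∈ σ.setups u) → ∀ v, (∃ a, (i, a) ∈ σ.setups v) →
      host i u = host i v → u = v ∨ sh i u ≠ sh i v)
    (h4 : ∀ i ∈ Hi, ∀ i' ∈ Hi, ∀ u, u ∈ H i → u ∈ H i' → i = i') :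
    ∃ σ₁ : PSchedule υ cl (fun j => if cl j ∈ Hi then t j else 0) s (3 / 2 * T),
      (∀ j, ∀ p ∈ σ₁.pieces j, cl j ∈ Hi ∧ p.1 ∈ H (cl j)) ∧
      (∀ u, ∀ q ∈ σ₁.setups u, q.1 ∈ Hi ∧ u ∈ H q.1) := by
  let φ : γ → υ × ℝ × ℝ → υ × ℝ × ℝ := fun i p =>
    (host i p.1, p.2.1 + sh i p.1, p.2.2 + sh i p.1)
  have hM : ∀ j, ∀ p ∈ σ.pieces j, ∃ a, (cl j, a) ∈ σ.setups p.1 := by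
    intro j p hp
    obtain ⟨a, ha, _⟩ := σ.setup_before j p hp
    exact ⟨a, ha⟩
  have hx : ∀ j, ∀ p ∈ σ.pieces j, s (cl j) ≤ p.2.1 := by
    intro j p hp
    obtain ⟨a, ha, hle, _⟩ := σ.setup_before j p hp
    have := (σ.setup_bounds _ _ ha).1
    simp only at this
    linarith
  have hC : ∀ j j', ∀ p ∈ σ.pieces j, ∀ q ∈ σ.pieces j', cl j ∈ Hi → cl j' ∈ Hi →
      (sh (cl j) p.1 ≠ sh (cl j') q.1 ∨ p.2.2 ≤ q.2.1 ∨ q.2.2 ≤ p.2.1) →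
      (φ (cl j) p).2.2 ≤ (φ (cl j') q).2.1 ∨ (φ (cl j') q).2.2 ≤ (φ (cl j) p).2.1 := by
    intro j j' p hp q hq hj hj' hor
    have a1 := hx j p hp
    have a2 := hx j' q hq
    have b1 := σ.pieces_bounds j p hp
    have b2 := σ.pieces_bounds j' q hq
    have c1 := hexp _ hj
    have c2 := hexp _ hj'
    simp only [φ]
    rcases h2 _ hj p.1 with e1 | e1 <;> rcases h2 _ hj' q.1 with e2 | e2 <;> rw [e1, e2]
    · rcases hor with h | h | h
      · exact absurd (e1.trans e2.symm) h
      · left; linarith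
      · right; linarith
    · left; linarith
    · right; linarith
    · rcases hor with h | h | h
      · exact absurd (e1.trans e2.symm) h
      · left; linarith
      · right; linarith
  have hmem : ∀ j p, p ∈ (if cl j ∈ Hi then (σ.pieces j).image (φ (cl j)) else ∅) ↔
      cl j ∈ Hi ∧ ∃ p' ∈ σ.pieces j, φ (cl j) p' = p := by
    intro j p; split_ifs with hq <;> simp [hq]
  have hmem2 : ∀ u q, q ∈ (Hi.filter (fun i => u ∈ H i)).image (fun i => (i, (0 : ℝ))) ↔
      q.1 ∈ Hi ∧ u ∈ H q.1 ∧ q.2 = 0 := by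
    intro u q
    simp only [Finset.mem_image, Finset.mem_filter]
    constructor
    · rintro ⟨i, hi, rfl⟩; exact ⟨hi.1, hi.2, rfl⟩
    · rintro ⟨h1, h2, h3⟩; exact ⟨q.1, ⟨h1, h2⟩, by ext <;> simp [h3]⟩
  have hshnn : ∀ i ∈ Hi, ∀ u, 0 ≤ sh i u ∧ sh i u ≤ T / 2 := by
    intro i hi u
    rcases h2 i hi u with e | e <;> rw [e] <;> constructor <;> linarith
  refine ⟨{ pieces := fun j => if cl j ∈ Hi then (σ.pieces j).image (φ (cl j)) else ∅
            setups := fun u => (Hi.filter (fun i => u ∈ H i)).image (fun i => (i, (0 : ℝ)))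
            pieces_bounds := ?_, pieces_no_parallel := ?_, pieces_sum := ?_, setup_bounds := ?_,
            machine_pieces_disjoint := ?_, machine_setups_disjoint := ?_,
            machine_piece_setup_disjoint := ?_, setup_before := ?_ }, ?_, ?_⟩
  · intro j p hp
    rw [hmem] at hp
    obtain ⟨hj, p', hp', rfl⟩ := hp
    have b1 := σ.pieces_bounds j p' hp'
    have := hshnn _ hj p'.1
    simp only [φ]
    refine ⟨?_, ?_, ?_⟩ <;> linarith
  · intro j p hp q hq hne
    rw [hmem] at hp hq
    obtain ⟨hj, p', hp', rfl⟩ := hp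
    obtain ⟨-, q', hq', rfl⟩ := hq
    have hne' : p' ≠ q' := fun e => hne (by rw [e])
    exact hC j j p' hp' q' hq' hj hj (Or.inr (σ.pieces_no_parallel j p' hp' q' hq' hne'))
  · intro j
    split_ifs with hj
    · rw [Finset.sum_image]
      · rw [← σ.pieces_sum j]
        apply Finset.sum_congr rfl
        intro p _
        simp only [φ]; ring
      · intro p hp q hq e
        by_contra hne
        have hp' : p ∈ σ.pieces j := hp
        have hq' : q ∈ σ.pieces j := hq
        have := hC j j p hp' q hq' hj hj (Or.inr (σ.pieces_no_parallel j p hp' q hq' hne))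
        rw [← e] at this
        have b1 := σ.pieces_bounds j p hp'
        simp only [φ] at this
        rcases this with h | h <;> linarith
    · simp
  · intro u q hq
    rw [hmem2] at hq
    rw [hq.2.2]
    have := hsT _ hq.1
    constructor <;> linarith
  · intro j₁ j₂ p hp q hq e hne
    rw [hmem] at hp hq
    obtain ⟨hj, p', hp', rfl⟩ := hp
    obtain ⟨hj', q', hq', rfl⟩ := hq
    apply hC j₁ j₂ p' hp' q' hq' hj hj'
    have m1 := hM j₁ p' hp'
    have m2 := hM j₂ q' hq'
    have e1 := h1 _ hj _ m1
    have e2 := h1 _ hj' _ m2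
    simp only [φ] at e
    rw [← e] at e2
    have ec := h4 _ hj _ hj' _ e1 e2
    rw [← ec] at m2 e ⊢
    rcases h3 _ hj _ m1 _ m2 e with h | h
    · right
      apply σ.machine_pieces_disjoint j₁ j₂ p' hp' q' hq' h
      rcases hne with h | h
      · exact Or.inl h
      · right
        rintro rfl
        exact h (by rw [ec])
    · exact Or.inl h
  · intro u p hp q hq hne
    rw [hmem2] at hp hq
    have ec := h4 _ hp.1 _ hq.1 _ hp.2.1 hq.2.1
    exact absurd (by ext <;> simp [ec, hp.2.2, hq.2.2]) hne
  · intro j p hp q hq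
    rw [hmem] at hp
    rw [hmem2] at hq
    obtain ⟨hj, p', hp', rfl⟩ := hp
    have e1 := h1 _ hj _ (hM j p' hp')
    have ec := h4 _ hj _ hq.1 _ e1 hq.2.1
    right
    rw [hq.2.2, ← ec]
    have := hx j p' hp'
    have := hshnn _ hj p'.1
    simp only [φ]
    linarith
  · intro j p hp
    rw [hmem] at hp
    obtain ⟨hj, p', hp', rfl⟩ := hp
    have e1 := h1 _ hj _ (hM j p' hp')
    have a1 := hx j p' hp'
    have a2 := hshnn _ hj p'.1
    refine ⟨0, ?_, ?_, ?_, ?_⟩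
    · rw [hmem2]; exact ⟨hj, e1, rfl⟩
    · simp only [φ]; linarith
    · intro q hq hne
      rw [hmem2] at hq
      exact absurd (h4 _ hj _ hq.1 _ e1 hq.2.1).symm hne
    · intro j' hne q hq e
      rw [hmem] at hq
      obtain ⟨hj', q', hq', rfl⟩ := hq
      have e2 := h1 _ hj' _ (hM j' q' hq')
      simp only [φ] at e
      rw [e] at e2
      exact absurd (h4 _ hj _ hj' _ e1 e2).symm hne
  · intro j p hp
    rw [hmem] at hp
    obtain ⟨hj, p', hp', rfl⟩ := hp
    exact ⟨hj, h1 _ hj _ (hM j p' hp')⟩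
  · intro u q hq
    rw [hmem2] at hq
    exact ⟨hq.1, hq.2.1⟩

/-- Cheap content of the machines in `Sm`, retimed into `[0, T / 2]`. -/
theorem aux_small {υ γ ι : Type*} [Fintype υ] [Fintype γ] [Fintype ι]
    {cl : ι → γ} {t : ι → ℝ} {s : γ → ℝ} {T : ℝ} (hT : 0 < T) (hs : ∀ i, 0 < s i)
    (σ : PSchedule υ cl t s T) (Ch : γ → Prop) (Sm : Finset υ)
    (hp : ∀ j, Ch (cl j) → ∀ p ∈ σ.pieces j, p.1 ∈ Sm → p.2.2 ≤ T / 4 ∨ 3 / 4 * T ≤ p.2.1)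
    (hq : ∀ u ∈ Sm, ∀ q ∈ σ.setups u, Ch q.1 → q.2 + s q.1 ≤ T / 4 ∨ 3 / 4 * T ≤ q.2) :
    ∃ σ₁ : PSchedule υ cl (fun j => if Ch (cl j) then
        ∑ p ∈ (σ.pieces j).filter (fun p => p.1 ∈ Sm), (p.2.2 - p.2.1) else 0) s (3 / 2 * T),
      (∀ j, ∀ p ∈ σ₁.pieces j, Ch (cl j) ∧ p.1 ∈ Sm ∧ p.2.2 ≤ T / 2) ∧
      (∀ u, ∀ q ∈ σ₁.setups u, Ch q.1 ∧ u ∈ Sm ∧ q.2 + s q.1 ≤ T / 2) ∧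
      (∀ u, pLoad σ₁ u ≤
        (∑ j ∈ univ.filter (fun j => Ch (cl j)),
          ∑ p ∈ (σ.pieces j).filter (fun p => p.1 = u), (p.2.2 - p.2.1)) +
        ∑ q ∈ (σ.setups u).filter (fun q => Ch q.1), s q.1) := by
  let θ : ℝ → ℝ := fun x => if x < T / 2 then 0 else T / 2
  let φ : υ × ℝ × ℝ → υ × ℝ × ℝ := fun p => (p.1, p.2.1 - θ p.2.1, p.2.2 - θ p.2.1)
  let ψ : γ × ℝ → γ × ℝ := fun q => (q.1, q.2 - θ q.2)
  have hth : ∀ x y : ℝ, x < y → (y ≤ T / 4 ∨ 3 / 4 * T ≤ x) →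
      (y ≤ T / 4 ∧ θ x = 0) ∨ (3 / 4 * T ≤ x ∧ θ x = T / 2) := by
    intro x y hxy h
    rcases h with h | h
    · left; exact ⟨h, if_pos (by linarith)⟩
    · right; exact ⟨h, if_neg (by linarith)⟩
  have hmem : ∀ j p, p ∈ (if Ch (cl j) then
      ((σ.pieces j).filter (fun p => p.1 ∈ Sm)).image φ else ∅) ↔
      Ch (cl j) ∧ ∃ p' ∈ σ.pieces j, p'.1 ∈ Sm ∧ φ p' = p := by
    intro j p; split_ifs with hq <;> simp [hq, and_assoc]
  have hmem2 : ∀ u q, q ∈ (if u ∈ Sm then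
      ((σ.setups u).filter (fun q => Ch q.1)).image ψ else ∅) ↔
      u ∈ Sm ∧ ∃ q' ∈ σ.setups u, Ch q'.1 ∧ ψ q' = q := by
    intro u q; split_ifs with hq <;> simp [hq, and_assoc]
  have PB : ∀ j, Ch (cl j) → ∀ p ∈ σ.pieces j, p.1 ∈ Sm →
      (0 ≤ p.2.1 ∧ p.2.1 < p.2.2 ∧ p.2.2 ≤ T) ∧
      ((p.2.2 ≤ T / 4 ∧ θ p.2.1 = 0) ∨ (3 / 4 * T ≤ p.2.1 ∧ θ p.2.1 = T / 2)) := by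
    intro j hj p hp1 hS
    have b := σ.pieces_bounds j p hp1
    exact ⟨b, hth _ _ b.2.1 (hp j hj p hp1 hS)⟩
  have QB : ∀ u ∈ Sm, ∀ q ∈ σ.setups u, Ch q.1 →
      (0 ≤ q.2 ∧ q.2 < q.2 + s q.1 ∧ q.2 + s q.1 ≤ T) ∧
      ((q.2 + s q.1 ≤ T / 4 ∧ θ q.2 = 0) ∨ (3 / 4 * T ≤ q.2 ∧ θ q.2 = T / 2)) := by
    intro u hu q hq1 hc
    have b := σ.setup_bounds u q hq1
    have := hs q.1
    have b' : q.2 < q.2 + s q.1 := by linarith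
    exact ⟨⟨b.1, b', b.2⟩, hth _ _ b' (hq u hu q hq1 hc)⟩
  have hdj : ∀ x y x' y' : ℝ, ((0 ≤ x ∧ x < y ∧ y ≤ T) ∧
      ((y ≤ T / 4 ∧ θ x = 0) ∨ (3 / 4 * T ≤ x ∧ θ x = T / 2))) →
      ((0 ≤ x' ∧ x' < y' ∧ y' ≤ T) ∧
      ((y' ≤ T / 4 ∧ θ x' = 0) ∨ (3 / 4 * T ≤ x' ∧ θ x' = T / 2))) →
      (y ≤ x' → y - θ x ≤ x' - θ x') ∧ (x ≤ x' → x - θ x ≤ x' - θ x') ∧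
      (y ≤ y' → y - θ x ≤ y' - θ x') := by
    rintro x y x' y' ⟨⟨a1, a2, a3⟩, h⟩ ⟨⟨b1, b2, b3⟩, h'⟩
    rcases h with ⟨h, e⟩ | ⟨h, e⟩ <;> rcases h' with ⟨h', e'⟩ | ⟨h', e'⟩ <;> rw [e, e'] <;>
      refine ⟨fun h => ?_, fun h => ?_, fun h => ?_⟩ <;> linarith
  have inj1 : ∀ j, Ch (cl j) →
      Set.InjOn φ ((σ.pieces j).filter (fun p => p.1 ∈ Sm) : Finset (υ × ℝ × ℝ)) := by
    intro j hj p hp1 q hq1 e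
    by_contra hne
    have hp' := Finset.mem_filter.1 (Finset.mem_coe.1 hp1)
    have hq' := Finset.mem_filter.1 (Finset.mem_coe.1 hq1)
    have bp := PB j hj p hp'.1 hp'.2
    have bq := PB j hj q hq'.1 hq'.2
    have e1 : p.2.1 - θ p.2.1 = q.2.1 - θ q.2.1 := congrArg (fun z => z.2.1) e
    have e2 : p.2.2 - θ p.2.1 = q.2.2 - θ q.2.1 := congrArg (fun z => z.2.2) e
    rcases σ.pieces_no_parallel j p hp'.1 q hq'.1 hne with h | h
    · have := (hdj _ _ _ _ bp bq).1 h
      linarith [bp.1.2.1]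
    · have := (hdj _ _ _ _ bq bp).1 h
      linarith [bp.1.2.1]
  have inj2 : ∀ u ∈ Sm,
      Set.InjOn ψ ((σ.setups u).filter (fun q => Ch q.1) : Finset (γ × ℝ)) := by
    intro u hu p hp1 q hq1 e
    by_contra hne
    have hp' := Finset.mem_filter.1 (Finset.mem_coe.1 hp1)
    have hq' := Finset.mem_filter.1 (Finset.mem_coe.1 hq1)
    have bp := QB u hu p hp'.1 hp'.2
    have bq := QB u hu q hq'.1 hq'.2
    have e1 : p.2 - θ p.2 = q.2 - θ q.2 := congrArg (fun z => z.2) e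
    rcases σ.machine_setups_disjoint u p hp'.1 q hq'.1 hne with h | h
    · have := (hdj _ _ _ _ bp bq).1 h
      linarith [bp.1.2.1]
    · have := (hdj _ _ _ _ bq bp).1 h
      linarith [bq.1.2.1]
  refine ⟨{ pieces := fun j => if Ch (cl j) then
              ((σ.pieces j).filter (fun p => p.1 ∈ Sm)).image φ else ∅
            setups := fun u => if u ∈ Sm then
              ((σ.setups u).filter (fun q => Ch q.1)).image ψ else ∅
            pieces_bounds := ?_, pieces_no_parallel := ?_, pieces_sum := ?_, setup_bounds := ?_,
            machine_pieces_disjoint := ?_, machine_setups_disjoint := ?_,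
            machine_piece_setup_disjoint := ?_, setup_before := ?_ }, ?_, ?_, ?_⟩
  · intro j p hp1
    rw [hmem] at hp1
    obtain ⟨hj, p', hp', hS, rfl⟩ := hp1
    obtain ⟨b1, b2⟩ := PB j hj p' hp' hS
    simp only [φ]
    rcases b2 with ⟨b, e⟩ | ⟨b, e⟩ <;> rw [e] <;> refine ⟨?_, ?_, ?_⟩ <;> linarith
  · intro j p hp1 q hq1 hne
    rw [hmem] at hp1 hq1
    obtain ⟨hj, p', hp', hS, rfl⟩ := hp1
    obtain ⟨-, q', hq', hS', rfl⟩ := hq1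
    have hne' : p' ≠ q' := fun e => hne (by rw [e])
    have bp := PB j hj p' hp' hS
    have bq := PB j hj q' hq' hS'
    exact (σ.pieces_no_parallel j p' hp' q' hq' hne').imp
      (hdj _ _ _ _ bp bq).1 (hdj _ _ _ _ bq bp).1
  · intro j
    split_ifs with hj
    · rw [Finset.sum_image (inj1 j hj)]
      apply Finset.sum_congr rfl
      intro p _
      simp only [φ]; ring
    · simp
  · intro u q hq1
    rw [hmem2] at hq1
    obtain ⟨hu, q', hq', hc, rfl⟩ := hq1
    obtain ⟨b1, b2⟩ := QB u hu q' hq' hc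
    simp only [ψ]
    rcases b2 with ⟨b, e⟩ | ⟨b, e⟩ <;> rw [e] <;> refine ⟨?_, ?_⟩ <;> linarith
  · intro j₁ j₂ p hp1 q hq1 e hne
    rw [hmem] at hp1 hq1
    obtain ⟨hj, p', hp', hS, rfl⟩ := hp1
    obtain ⟨hj', q', hq', hS', rfl⟩ := hq1
    have bp := PB j₁ hj p' hp' hS
    have bq := PB j₂ hj' q' hq' hS'
    have hne' : j₁ ≠ j₂ ∨ p' ≠ q' := hne.imp id (fun h e => h (by rw [e]))
    exact (σ.machine_pieces_disjoint j₁ j₂ p' hp' q' hq' e hne').imp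
      (hdj _ _ _ _ bp bq).1 (hdj _ _ _ _ bq bp).1
  · intro u p hp1 q hq1 hne
    rw [hmem2] at hp1 hq1
    obtain ⟨hu, p', hp', hS, rfl⟩ := hp1
    obtain ⟨-, q', hq', hS', rfl⟩ := hq1
    have bp := QB u hu p' hp' hS
    have bq := QB u hu q' hq' hS'
    have hne' : p' ≠ q' := fun e => hne (by rw [e])
    rcases σ.machine_setups_disjoint u p' hp' q' hq' hne' with h | h
    · left
      have := (hdj _ _ _ _ bp bq).1 h
      simp only [ψ]; linarith
    · right
      have := (hdj _ _ _ _ bq bp).1 h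
      simp only [ψ]; linarith
  · intro j p hp1 q hq1
    rw [hmem] at hp1
    rw [hmem2] at hq1
    obtain ⟨hj, p', hp', hS, rfl⟩ := hp1
    obtain ⟨hu, q', hq', hS', rfl⟩ := hq1
    have bp := PB j hj p' hp' hS
    have bq := QB _ hu q' hq' hS'
    rcases σ.machine_piece_setup_disjoint j p' hp' q' hq' with h | h
    · left
      exact (hdj _ _ _ _ bp bq).1 h
    · right
      have := (hdj _ _ _ _ bq bp).1 h
      simp only [ψ, φ]; linarith
  · intro j p hp1
    rw [hmem] at hp1
    obtain ⟨hj, p', hp', hS, rfl⟩ := hp1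
    have bp := PB j hj p' hp' hS
    obtain ⟨a, ha, hle, hA, hB⟩ := σ.setup_before j p' hp'
    have ba := QB _ hS _ ha hj
    simp only at ba
    refine ⟨a - θ a, ?_, ?_, ?_, ?_⟩
    · rw [hmem2]
      exact ⟨hS, _, ha, hj, rfl⟩
    · have := (hdj _ _ _ _ ba bp).1 hle
      simp only [φ]; linarith
    · intro q hq1 hne
      rw [hmem2] at hq1
      obtain ⟨hu, q', hq', hS', rfl⟩ := hq1
      have bq := QB _ hu q' hq' hS'
      rintro ⟨x1, x2⟩
      simp only [φ, ψ] at x1 x2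
      apply hA q' hq' hne
      constructor
      · by_contra hcon
        have := (hdj _ _ _ _ bp bq).2.1 (not_lt.1 hcon)
        linarith
      · by_contra hcon
        have := (hdj _ _ _ _ bq ba).2.2 (not_lt.1 hcon)
        linarith
    · intro j' hne q hq1 e
      rw [hmem] at hq1
      obtain ⟨hj', q', hq', hS', rfl⟩ := hq1
      have bq := PB j' hj' q' hq' hS'
      rintro ⟨x1, x2⟩
      simp only [φ] at x1 x2
      apply hB j' hne q' hq' e
      constructor
      · by_contra hcon
        have := (hdj _ _ _ _ bp bq).2.1 (not_lt.1 hcon)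
        linarith
      · by_contra hcon
        have := (hdj _ _ _ _ bq ba).2.2 (not_lt.1 hcon)
        linarith
  · intro j p hp1
    rw [hmem] at hp1
    obtain ⟨hj, p', hp', hS, rfl⟩ := hp1
    obtain ⟨b1, b2⟩ := PB j hj p' hp' hS
    refine ⟨hj, hS, ?_⟩
    simp only [φ]
    rcases b2 with ⟨b, e⟩ | ⟨b, e⟩ <;> rw [e] <;> linarith
  · intro u q hq1
    rw [hmem2] at hq1
    obtain ⟨hu, q', hq', hc, rfl⟩ := hq1
    obtain ⟨b1, b2⟩ := QB u hu q' hq' hc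
    refine ⟨hc, hu, ?_⟩
    simp only [ψ]
    rcases b2 with ⟨b, e⟩ | ⟨b, e⟩ <;> rw [e] <;> linarith
  · intro u
    simp only [pLoad]
    apply add_le_add
    · rw [Finset.sum_filter]
      apply Finset.sum_le_sum
      intro j _
      split_ifs with hj
      · rw [Finset.filter_image, Finset.sum_image]
        · simp only [φ, sub_sub_sub_cancel_right]
          apply Finset.sum_le_sum_of_subset_of_nonneg
          · intro p hp1
            simp only [Finset.mem_filter] at hp1 ⊢
            exact ⟨hp1.1.1, hp1.2⟩
          · intro p hp1 _
            have := σ.pieces_bounds j p (Finset.mem_filter.1 hp1).1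
            linarith
        · intro p hp1 q hq1 e
          exact inj1 j hj (Finset.mem_coe.2 (Finset.mem_filter.1 (Finset.mem_coe.1 hp1)).1)
            (Finset.mem_coe.2 (Finset.mem_filter.1 (Finset.mem_coe.1 hq1)).1) e
      · simp
    · split_ifs with hu
      · rw [Finset.sum_image (inj2 u hu)]
      · rw [Finset.sum_empty]
        exact Finset.sum_nonneg (fun q _ => (hs q.1).le)

/-- Cutting the interval `[A, B]` at the multiples of `T`. -/
theorem aux_cut (T A B : ℝ) (hT : 0 < T) (hA : 0 ≤ A) (hAB : A ≤ B) (m : ℕ) (hB : B ≤ m * T) :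
    ∑ f ∈ (univ : Finset (Fin m)).filter
      (fun f : Fin m => max A ((f : ℕ) * T) < min B (((f : ℕ) + 1) * T)),
      (min B (((f : ℕ) + 1) * T) - max A ((f : ℕ) * T)) = B - A := by
  have key : ∀ n : ℕ, (if max A ((n : ℕ) * T) < min B (((n : ℕ) + 1) * T) then
      (min B (((n : ℕ) + 1) * T) - max A ((n : ℕ) * T)) else 0) =
      min (max A (((n + 1 : ℕ) : ℝ) * T)) B - min (max A ((n : ℝ) * T)) B := by
    intro n
    have e : (((n + 1 : ℕ) : ℝ) * T) = n * T + T := by push_cast; ring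
    have e' : (((n : ℕ) : ℝ) + 1) * T = n * T + T := by ring
    rw [e, e']
    generalize (n : ℝ) * T = z
    rcases le_total A z with h1 | h1 <;> rcases le_total B (z + T) with h2 | h2 <;>
      rcases le_total A (z + T) with h3 | h3 <;> rcases le_total z B with h4 | h4 <;>
      simp only [max_eq_left, max_eq_right, min_eq_left, min_eq_right, h1, h2, h3, h4, hAB] <;>
      split_ifs <;> linarith
  rw [Finset.sum_filter]
  rw [Fin.sum_univ_eq_sum_range (fun n : ℕ => if max A ((n : ℕ) * T) < min B (((n : ℕ) + 1) * T)
    then (min B (((n : ℕ) + 1) * T) - max A ((n : ℕ) * T)) else 0) m]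
  rw [Finset.sum_congr rfl (fun n _ => key n),
    Finset.sum_range_sub (fun n : ℕ => min (max A ((n : ℝ) * T)) B)]
  have h0 : max A (((0 : ℕ) : ℝ) * T) = A := by simp [hA]
  rw [h0, min_eq_left hAB, min_eq_right (le_trans hB (le_max_right _ _))]

/-- McNaughton-style wrap-around of the residual cheap jobs in the gaps `[T/2, 3T/2]`. -/
theorem aux_wrap {υ γ ι : Type*} [Fintype υ] [Fintype γ] [Fintype ι]
    (cl : ι → γ) (r : ι → ℝ) (s : γ → ℝ) (T : ℝ) (hT : 0 < T) (hs : ∀ i, 0 < s i)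
    (hr : ∀ j, 0 ≤ r j) (hrT : ∀ j, r j ≤ T) (R : γ → ℝ)
    (hR : ∀ c, R c = ∑ j ∈ univ.filter (fun j => cl j = c), r j)
    (hsT : ∀ c, 0 < R c → s c ≤ T / 2) (L : ℝ)
    (hL : L = ∑ c ∈ univ.filter (fun c => 0 < R c), (s c + R c))
    (m : ℕ) (hLm : L ≤ m * T) (e : Fin m → υ) (he : Function.Injective e) :
    ∃ σ₁ : PSchedule υ cl r s (3 / 2 * T),
      (∀ j, ∀ p ∈ σ₁.pieces j, 0 < R (cl j) ∧ ∃ f : Fin m, p.1 = e f ∧ T / 2 ≤ p.2.1 ∧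
        p.2.2 ≤ T / 2 + L - (f : ℕ) * T) ∧
      (∀ u, ∀ q ∈ σ₁.setups u, 0 < R q.1 ∧ ∃ f : Fin m, u = e f ∧
        q.2 + s q.1 ≤ T / 2 + L - (f : ℕ) * T) := by
  have hR0 : ∀ c, 0 ≤ R c := fun c => by
    rw [hR]; exact Finset.sum_nonneg (fun j _ => hr j)
  have hrR : ∀ j, r j ≤ R (cl j) := by
    intro j
    rw [hR]
    exact Finset.single_le_sum (f := r) (fun k _ => hr k) (by simp)
  obtain ⟨x, hx1, hx2⟩ := aux_layout (univ.filter (fun c => 0 < R c)) (fun c => s c + R c)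
    (fun c => add_nonneg (hs c).le (hR0 c))
  simp only [← hL] at hx1
  obtain ⟨y, hy1, hy2⟩ := aux_joblayout cl r hr
  simp only [← hR] at hy1
  simp only [Finset.mem_filter, Finset.mem_univ, true_and] at hx1 hx2
  let A : ι → ℝ := fun j => x (cl j) + s (cl j) + y j
  let B : ι → ℝ := fun j => x (cl j) + s (cl j) + y j + r j
  let lo : ℝ → Fin m → ℝ := fun a f => max a ((f : ℕ) * T)
  let hi : ℝ → Fin m → ℝ := fun b f => min b (((f : ℕ) + 1) * T)
  let CA : γ → ℝ := fun c => x c + s c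
  let CB : γ → ℝ := fun c => x c + s c + R c
  let pc : ι → Fin m → υ × ℝ × ℝ := fun j f =>
    (e f, T / 2 + lo (A j) f - (f : ℕ) * T, T / 2 + hi (B j) f - (f : ℕ) * T)
  let st : γ → Fin m → γ × ℝ := fun c f => (c, T / 2 + lo (CA c) f - (f : ℕ) * T - s c)
  have hlo1 : ∀ (a : ℝ) (f : Fin m), a ≤ lo a f := fun a f => le_max_left _ _
  have hlo2 : ∀ (a : ℝ) (f : Fin m), (f : ℕ) * T ≤ lo a f := fun a f => le_max_right _ _
  have hhi1 : ∀ (b : ℝ) (f : Fin m), hi b f ≤ b := fun b f => min_le_left _ _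
  have hhi2 : ∀ (b : ℝ) (f : Fin m), hi b f ≤ ((f : ℕ) + 1) * T := fun b f => min_le_right _ _
  have hlomono : ∀ a a' f, a ≤ a' → lo a f ≤ lo a' f := fun a a' f h => max_le_max_right _ h
  have hhimono : ∀ a a' f, a ≤ a' → hi a f ≤ hi a' f := fun a a' f h => min_le_min_right _ h
  have hCAA : ∀ j, CA (cl j) ≤ A j := fun j => by
    have := (hy1 j).1
    simp only [CA, A]; linarith
  have hBCB : ∀ j, B j ≤ CB (cl j) := fun j => by
    have := (hy1 j).2
    simp only [CB, B]; linarith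
  have hact : ∀ j f, lo (A j) f < hi (B j) f → 0 < r j ∧ 0 < R (cl j) ∧
      lo (CA (cl j)) f < hi (CB (cl j)) f := by
    intro j f h
    have h1 := hlo1 (A j) f
    have h2 := hhi1 (B j) f
    have h3 : 0 < r j := by simp only [A, B] at *; linarith
    refine ⟨h3, lt_of_lt_of_le h3 (hrR j), ?_⟩
    exact lt_of_le_of_lt (hlomono _ _ f (hCAA j)) (lt_of_lt_of_le h (hhimono _ _ f (hBCB j)))
  have hmem : ∀ j p, p ∈ ((univ : Finset (Fin m)).filter
      (fun f => lo (A j) f < hi (B j) f)).image (pc j) ↔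
      ∃ f, lo (A j) f < hi (B j) f ∧ pc j f = p := by
    intro j p; simp
  have hmem2 : ∀ u q, q ∈ ((univ : Finset (γ × Fin m)).filter (fun cf => 0 < R cf.1 ∧
      lo (CA cf.1) cf.2 < hi (CB cf.1) cf.2 ∧ e cf.2 = u)).image (fun cf => st cf.1 cf.2) ↔
      ∃ c f, 0 < R c ∧ lo (CA c) f < hi (CB c) f ∧ e f = u ∧ st c f = q := by
    intro u q; simp [and_assoc]
  refine ⟨{ pieces := fun j => ((univ : Finset (Fin m)).filter
              (fun f => lo (A j) f < hi (B j) f)).image (pc j)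
            setups := fun u => ((univ : Finset (γ × Fin m)).filter (fun cf => 0 < R cf.1 ∧
              lo (CA cf.1) cf.2 < hi (CB cf.1) cf.2 ∧ e cf.2 = u)).image
                (fun cf => st cf.1 cf.2)
            pieces_bounds := ?_, pieces_no_parallel := ?_, pieces_sum := ?_, setup_bounds := ?_,
            machine_pieces_disjoint := ?_, machine_setups_disjoint := ?_,
            machine_piece_setup_disjoint := ?_, setup_before := ?_ }, ?_, ?_⟩
  · intro j p hp
    rw [hmem] at hp
    obtain ⟨f, hf, rfl⟩ := hp
    have h1 := hlo2 (A j) f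
    have h2 := hhi2 (B j) f
    simp only [pc]
    refine ⟨?_, ?_, ?_⟩ <;> linarith
  · intro j p hp q hq hne
    rw [hmem] at hp hq
    obtain ⟨f, hf, rfl⟩ := hp
    obtain ⟨g, hg, rfl⟩ := hq
    have main : ∀ f g : Fin m, (f : ℕ) < (g : ℕ) → (pc j g).2.2 ≤ (pc j f).2.1 := by
      intro f g hfg
      have h1 := hlo1 (A j) f
      have h2 := hhi1 (B j) g
      have h3 := hrT j
      have h4 : ((f : ℕ) : ℝ) + 1 ≤ ((g : ℕ) : ℝ) := by exact_mod_cast hfg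
      have h5 := mul_le_mul_of_nonneg_right h4 hT.le
      simp only [pc]
      simp only [A, B] at *
      linarith
    rcases lt_trichotomy (f : ℕ) (g : ℕ) with h | h | h
    · right; exact main f g h
    · exact absurd (by rw [Fin.ext h]) hne
    · left; exact main g f h
  · intro j
    rw [Finset.sum_image]
    · simp only [pc]
      have : ∀ f : Fin m, T / 2 + hi (B j) f - (f : ℕ) * T - (T / 2 + lo (A j) f - (f : ℕ) * T) =
        hi (B j) f - lo (A j) f := fun f => by ring
      rw [Finset.sum_congr rfl (fun f _ => this f)]
      by_cases h0 : 0 < r j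
      · have hRj := lt_of_lt_of_le h0 (hrR j)
        have b1 := hx1 _ hRj
        have b2 := hy1 j
        have b3 := hs (cl j)
        have := aux_cut T (A j) (B j) hT (by simp only [A]; linarith)
          (by simp only [A, B]; linarith) m (by simp only [B]; linarith)
        simp only [hi, lo]
        rw [this]
        simp only [A, B]; ring
      · have h0' : r j = 0 := le_antisymm (not_lt.1 h0) (hr j)
        rw [h0', Finset.filter_false_of_mem, Finset.sum_empty]
        intro f _ hf
        exact h0 (hact j f hf).1
    · intro f _ g _ h
      exact he (congrArg (fun z => z.1) h)
  · intro u q hq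
    rw [hmem2] at hq
    obtain ⟨c, f, hc, hf, hu, rfl⟩ := hq
    have h1 := hlo2 (CA c) f
    have h2 := hhi2 (CB c) f
    have h3 := hsT c hc
    simp only [st]
    constructor <;> linarith
  · intro j₁ j₂ p hp q hq hpq hne
    rw [hmem] at hp hq
    obtain ⟨f, hf, rfl⟩ := hp
    obtain ⟨g, hg, rfl⟩ := hq
    obtain rfl : f = g := he hpq
    have hj : j₁ ≠ j₂ := by
      rcases hne with h | h
      · exact h
      · rintro rfl; exact h rfl
    have a1 := hlo1 (A j₁) f
    have a2 := hlo1 (A j₂) f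
    have b1 := hhi1 (B j₁) f
    have b2 := hhi1 (B j₂) f
    have : B j₁ ≤ A j₂ ∨ B j₂ ≤ A j₁ := by
      by_cases hc : cl j₁ = cl j₂
      · have := hy2 j₁ j₂ hc hj
        simp only [A, B, hc]
        rcases this with h | h
        · left; linarith
        · right; linarith
      · have := hx2 _ (hact _ _ hf).2.1 _ (hact _ _ hg).2.1 hc
        have c1 := hCAA j₁
        have c2 := hCAA j₂
        have d1 := hBCB j₁
        have d2 := hBCB j₂
        have s1 := hs (cl j₁)
        have s2 := hs (cl j₂)
        simp only [CA, CB] at c1 c2 d1 d2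
        rcases this with h | h
        · left; linarith
        · right; linarith
    simp only [pc]
    rcases this with h | h
    · left; linarith
    · right; linarith
  · intro u p hp q hq hne
    rw [hmem2] at hp hq
    obtain ⟨c, f, hc, hf, hu, rfl⟩ := hp
    obtain ⟨c', g, hc', hg, hu', rfl⟩ := hq
    obtain rfl : f = g := he (hu.trans hu'.symm)
    have hcc : c ≠ c' := by rintro rfl; exact hne rfl
    have a1 := hlo1 (CA c) f
    have a2 := hlo1 (CA c') f
    have b1 := hhi1 (CB c) f
    have b2 := hhi1 (CB c') f
    simp only [st]
    rcases hx2 _ hc _ hc' hcc with h | h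
    · left; simp only [CA, CB] at *; linarith
    · right; simp only [CA, CB] at *; linarith
  · intro j p hp q hq
    rw [hmem] at hp
    obtain ⟨f, hf, rfl⟩ := hp
    rw [hmem2] at hq
    obtain ⟨c', g, hc', hg, hu', rfl⟩ := hq
    obtain rfl : g = f := he hu'
    have hh := hact _ _ hf
    have a1 := hlo1 (A j) g
    have a2 := hlo1 (CA c') g
    have b1 := hhi1 (B j) g
    have b2 := hhi1 (CB c') g
    have c1 := hCAA j
    have d1 := hBCB j
    have s1 := hs (cl j)
    simp only [st, pc]
    by_cases hcc : cl j = c'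
    · subst hcc
      right
      have := hlomono _ _ g c1
      linarith
    · rcases hx2 _ hh.2.1 _ hc' hcc with h | h
      · left; simp only [CA, CB] at *; linarith
      · right; simp only [CA, CB] at *; linarith
  · intro j p hp
    rw [hmem] at hp
    obtain ⟨f, hf, rfl⟩ := hp
    have hh := hact _ _ hf
    have a1 := hlo1 (A j) f
    have a3 := hlo1 (CA (cl j)) f
    have b1 := hhi1 (B j) f
    have c1 := hCAA j
    have d1 := hBCB j
    have s1 := hs (cl j)
    have l1 := hlomono _ _ f c1
    refine ⟨(st (cl j) f).2, ?_, ?_, ?_, ?_⟩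
    · rw [hmem2]
      exact ⟨cl j, f, hh.2.1, hh.2.2, rfl, rfl⟩
    · simp only [st, pc]; linarith
    · intro q hq hne
      rw [hmem2] at hq
      obtain ⟨c', g, hc', hg, hu', rfl⟩ := hq
      obtain rfl : g = f := he hu'
      have a2 := hlo1 (CA c') g
      have b2 := hhi1 (CB c') g
      have s2 := hs c'
      rintro ⟨z1, z2⟩
      simp only [st, pc] at z1 z2
      rcases hx2 _ hh.2.1 _ hc' (Ne.symm hne) with h | h <;> simp only [CA, CB] at * <;> linarith
    · intro j' hne p' hp' hpe
      rw [hmem] at hp'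
      obtain ⟨g, hg, rfl⟩ := hp'
      obtain rfl : g = f := he hpe
      have hh' := hact _ _ hg
      have a2 := hlo1 (A j') g
      have b2 := hhi1 (B j') g
      have c2 := hCAA j'
      have d2 := hBCB j'
      have s2 := hs (cl j')
      rintro ⟨z1, z2⟩
      simp only [st, pc] at z1 z2
      rcases hx2 _ hh.2.1 _ hh'.2.1 (Ne.symm hne) with h | h <;> simp only [CA, CB] at * <;> linarith
  · intro j p hp
    rw [hmem] at hp
    obtain ⟨f, hf, rfl⟩ := hp
    have hh := hact _ _ hf
    refine ⟨hh.2.1, f, rfl, ?_, ?_⟩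
    · have := hlo2 (A j) f
      simp only [pc]; linarith
    · have b1 := hhi1 (B j) f
      have d1 := hBCB j
      have := (hx1 _ hh.2.1).2
      simp only [pc, CB] at *
      linarith
  · intro u q hq
    rw [hmem2] at hq
    obtain ⟨c, f, hc, hf, hu, rfl⟩ := hq
    refine ⟨hc, f, hu.symm, ?_⟩
    have b1 := hhi1 (CB c) f
    have := (hx1 _ hc).2
    simp only [st, CB] at *
    linarith

/-- The total length of the items of classes satisfying `Ch` on machine `u`. -/
noncomputable def cLoad {υ γ ι : Type*} [Fintype υ] [Fintype γ] [Fintype ι]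
    {cl : ι → γ} {t : ι → ℝ} {s : γ → ℝ} {M : ℝ}
    (σ : PSchedule υ cl t s M) (Ch : γ → Prop) (u : υ) : ℝ :=
  (∑ j ∈ univ.filter (fun j => Ch (cl j)),
    ∑ p ∈ (σ.pieces j).filter (fun p => p.1 = u), (p.2.2 - p.2.1)) +
  ∑ q ∈ (σ.setups u).filter (fun q => Ch q.1), s q.1

/-- Every load is at most the makespan. -/
theorem aux_load {υ γ ι : Type*} [Fintype υ] [Fintype γ] [Fintype ι]
    {cl : ι → γ} {t : ι → ℝ} {s : γ → ℝ} {M : ℝ} (hM : 0 ≤ M) (hs : ∀ i, 0 < s i)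
    (σ : PSchedule υ cl t s M) (u : υ) : pLoad σ u ≤ M := by
  let K : Finset ((Σ _ : ι, υ × ℝ × ℝ) ⊕ (γ × ℝ)) :=
    ((univ : Finset ι).sigma (fun j => (σ.pieces j).filter (fun p => p.1 = u))).disjSum (σ.setups u)
  let x : (Σ _ : ι, υ × ℝ × ℝ) ⊕ (γ × ℝ) → ℝ := Sum.elim (fun z => z.2.2.1) (fun q => q.2)
  let y : (Σ _ : ι, υ × ℝ × ℝ) ⊕ (γ × ℝ) → ℝ := Sum.elim (fun z => z.2.2.2) (fun q => q.2 + s q.1)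
  have h := aux_pack K x y 0 M hM ?_ ?_
  · have e : ∑ k ∈ K, (y k - x k) = pLoad σ u := by
      simp only [K, x, y, pLoad, Finset.sum_disjSum, Finset.sum_sigma, Sum.elim_inl, Sum.elim_inr,
        add_sub_cancel_left]
    rw [e] at h
    linarith
  · rintro (⟨j, p⟩ | q) hk
    · simp only [K, Finset.inl_mem_disjSum, Finset.mem_sigma, Finset.mem_filter] at hk
      exact σ.pieces_bounds j p hk.2.1
    · simp only [K, Finset.inr_mem_disjSum] at hk
      have := σ.setup_bounds u q hk
      have h2 := hs q.1
      simp only [x, y, Sum.elim_inr]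
      exact ⟨this.1, by linarith, this.2⟩
  · rintro (⟨j, p⟩ | q) hk (⟨j', p'⟩ | q') hk' hne
    · simp only [K, Finset.inl_mem_disjSum, Finset.mem_sigma, Finset.mem_filter] at hk hk'
      apply σ.machine_pieces_disjoint j j' p hk.2.1 p' hk'.2.1 (hk.2.2.trans hk'.2.2.symm)
      by_contra hcon
      push Not at hcon
      exact hne (by rw [hcon.1, hcon.2])
    · simp only [K, Finset.inl_mem_disjSum, Finset.inr_mem_disjSum, Finset.mem_sigma,
        Finset.mem_filter] at hk hk'
      exact σ.machine_piece_setup_disjoint j p hk.2.1 q' (by rw [hk.2.2]; exact hk')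
    · simp only [K, Finset.inl_mem_disjSum, Finset.inr_mem_disjSum, Finset.mem_sigma,
        Finset.mem_filter] at hk hk'
      exact (σ.machine_piece_setup_disjoint j' p' hk'.2.1 q (by rw [hk'.2.2]; exact hk)).symm
    · simp only [K, Finset.inr_mem_disjSum] at hk hk'
      exact σ.machine_setups_disjoint u q hk q' hk' (fun e => hne (by rw [e]))

theorem aux_cLoad_nonneg {υ γ ι : Type*} [Fintype υ] [Fintype γ] [Fintype ι]
    {cl : ι → γ} {t : ι → ℝ} {s : γ → ℝ} {M : ℝ} (hs : ∀ i, 0 < s i)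
    (σ : PSchedule υ cl t s M) (Ch : γ → Prop) (u : υ) : 0 ≤ cLoad σ Ch u := by
  unfold cLoad
  apply add_nonneg
  · apply Finset.sum_nonneg; intro j _
    apply Finset.sum_nonneg; intro p hp
    have := σ.pieces_bounds j p (Finset.mem_filter.1 hp).1
    linarith
  · exact Finset.sum_nonneg (fun q _ => (hs q.1).le)

theorem aux_pLoad_nonneg {υ γ ι : Type*} [Fintype υ] [Fintype γ] [Fintype ι]
    {cl : ι → γ} {t : ι → ℝ} {s : γ → ℝ} {M : ℝ} (hs : ∀ i, 0 < s i)
    (σ : PSchedule υ cl t s M) (u : υ) : 0 ≤ pLoad σ u := by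
  unfold pLoad
  apply add_nonneg
  · apply Finset.sum_nonneg; intro j _
    apply Finset.sum_nonneg; intro p hp
    have := σ.pieces_bounds j p (Finset.mem_filter.1 hp).1
    linarith
  · exact Finset.sum_nonneg (fun q _ => (hs q.1).le)

theorem aux_pLoad_zero {υ γ ι : Type*} [Fintype υ] [Fintype γ] [Fintype ι]
    {cl : ι → γ} {t : ι → ℝ} {s : γ → ℝ} {M : ℝ}
    (σ : PSchedule υ cl t s M) (u : υ) (h1 : ∀ j, ∀ p ∈ σ.pieces j, p.1 ≠ u)
    (h2 : ∀ q ∈ σ.setups u, False) : pLoad σ u = 0 := by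
  unfold pLoad
  rw [Finset.sum_eq_zero, Finset.sum_eq_zero, add_zero]
  · intro q hq; exact (h2 q hq).elim
  · intro j _
    apply Finset.sum_eq_zero
    intro p hp
    rw [Finset.mem_filter] at hp
    exact absurd hp.2 (h1 j p hp.1)

/-- The cheap load on a machine carrying the expensive class `i`. -/
theorem aux_cLoad {υ γ ι : Type*} [Fintype υ] [Fintype γ] [Fintype ι]
    {cl : ι → γ} {t : ι → ℝ} {s : γ → ℝ} {T : ℝ} (hT : 0 ≤ T) (hs : ∀ i, 0 < s i)
    (σ : PSchedule υ cl t s T) (Ch : γ → Prop) (i : γ) (hi : ¬ Ch i) (u : υ)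
    (hu : ∃ a, (i, a) ∈ σ.setups u) :
    cLoad σ Ch u + s i + ∑ j ∈ univ.filter (fun j => cl j = i),
      ∑ p ∈ (σ.pieces j).filter (fun p => p.1 = u), (p.2.2 - p.2.1) ≤ T := by
  have h := aux_load hT hs σ u
  obtain ⟨a, ha⟩ := hu
  have nn : ∀ j, 0 ≤ ∑ p ∈ (σ.pieces j).filter (fun p => p.1 = u), (p.2.2 - p.2.1) := by
    intro j
    apply Finset.sum_nonneg; intro p hp
    have := σ.pieces_bounds j p (Finset.mem_filter.1 hp).1
    linarith
  unfold pLoad at h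
  unfold cLoad
  rw [← Finset.sum_filter_add_sum_filter_not univ (fun j => Ch (cl j)),
    ← Finset.sum_filter_add_sum_filter_not (σ.setups u) (fun q => Ch q.1)] at h
  have h1 : ∑ j ∈ univ.filter (fun j => cl j = i),
      ∑ p ∈ (σ.pieces j).filter (fun p => p.1 = u), (p.2.2 - p.2.1) ≤
      ∑ j ∈ univ.filter (fun j => ¬ Ch (cl j)),
      ∑ p ∈ (σ.pieces j).filter (fun p => p.1 = u), (p.2.2 - p.2.1) := by
    apply Finset.sum_le_sum_of_subset_of_nonneg
    · intro j hj
      simp only [Finset.mem_filter, Finset.mem_univ, true_and] at hj ⊢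
      rw [hj]; exact hi
    · intro j _ _; exact nn j
  have h2 : s i ≤ ∑ q ∈ (σ.setups u).filter (fun q => ¬ Ch q.1), s q.1 :=
    Finset.single_le_sum (f := fun q : γ × ℝ => s q.1) (fun q _ => (hs q.1).le)
      (Finset.mem_filter.2 ⟨ha, hi⟩)
  linarith

theorem aux_cLoad_sum {υ γ ι : Type*} [Fintype υ] [Fintype γ] [Fintype ι]
    {cl : ι → γ} {t : ι → ℝ} {s : γ → ℝ} {T : ℝ} (hT : 0 ≤ T) (hs : ∀ i, 0 < s i)
    (σ : PSchedule υ cl t s T) (Ch : γ → Prop) (i : γ) (hi : ¬ Ch i) (P : ℝ)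
    (hP : P = ∑ j ∈ univ.filter (fun j => cl j = i), t j) (M : Finset υ)
    (hM : ∀ u, u ∈ M ↔ ∃ a, (i, a) ∈ σ.setups u) :
    ∑ u ∈ M, cLoad σ Ch u ≤ M.card * (T - s i) - P := by
  have h5 : ∑ u ∈ M, ∑ j ∈ univ.filter (fun j => cl j = i),
      ∑ p ∈ (σ.pieces j).filter (fun p => p.1 = u), (p.2.2 - p.2.1) = P := by
    rw [Finset.sum_comm, hP]
    apply Finset.sum_congr rfl
    intro j hj
    rw [← σ.pieces_sum j]
    apply Finset.sum_fiberwise_of_maps_to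
    intro p hp
    obtain ⟨a, ha, _⟩ := σ.setup_before j p hp
    rw [hM]
    rw [(Finset.mem_filter.1 hj).2] at ha
    exact ⟨a, ha⟩
  have h6 := Finset.sum_le_sum (fun u (hu : u ∈ M) => aux_cLoad hT hs σ Ch i hi u ((hM u).1 hu))
  rw [Finset.sum_add_distrib, Finset.sum_add_distrib, h5] at h6
  simp only [Finset.sum_const, nsmul_eq_mul] at h6
  linarith

/-- Two expensive setups never share a machine. -/
theorem aux_two {υ γ ι : Type*} [Fintype υ] [Fintype γ] [Fintype ι]
    {cl : ι → γ} {t : ι → ℝ} {s : γ → ℝ} {T : ℝ}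
    (σ : PSchedule υ cl t s T) (u : υ) (q q' : γ × ℝ) (hq : q ∈ σ.setups u)
    (hq' : q' ∈ σ.setups u) (h : T / 2 < s q.1) (h' : T / 2 < s q'.1) : q = q' := by
  by_contra hne
  have b := σ.setup_bounds u q hq
  have b' := σ.setup_bounds u q' hq'
  rcases σ.machine_setups_disjoint u q hq q' hq' hne with h | h <;> linarith

/-- An item on a machine that carries a whole class of `I_exp^0` sits at one of the two ends. -/
theorem aux_gap {υ γ ι : Type*} [Fintype υ] [Fintype γ] [Fintype ι]
    {cl : ι → γ} {t : ι → ℝ} {s : γ → ℝ} {T : ℝ}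
    (σ : PSchedule υ cl t s T) (i : γ) (P : ℝ)
    (hP : P = ∑ j ∈ univ.filter (fun j => cl j = i), t j)
    (h34 : 3 / 4 * T < s i + P) (u : υ) (a : ℝ) (ha : (i, a) ∈ σ.setups u)
    (hua : ∀ a', (i, a') ∈ σ.setups u → a' = a)
    (hall : ∀ j, cl j = i → ∀ p ∈ σ.pieces j, p.1 = u) (x y : ℝ) (hxy : x < y)
    (hd : y ≤ a ∨ a + s i ≤ x)
    (hsep : ∀ j, cl j = i → ∀ p ∈ σ.pieces j, p.2.2 ≤ x ∨ y ≤ p.2.1)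
    (hbef : ∀ j, cl j = i → ∀ p ∈ σ.pieces j, ¬ (x < p.2.1 ∧ a + s i < y)) :
    y ≤ T / 4 ∨ 3 / 4 * T ≤ x := by
  have hst : ∀ j, cl j = i → ∀ p ∈ σ.pieces j, a + s i ≤ p.2.1 := by
    intro j hj p hp
    obtain ⟨a', ha', hle, _⟩ := σ.setup_before j p hp
    rw [hall j hj p hp, hj] at ha'
    rw [hua a' ha', hj] at hle
    exact hle
  have hb := σ.setup_bounds u _ ha
  simp only at hb
  have pack : ∀ z, a + s i ≤ z → (∀ j, cl j = i → ∀ p ∈ σ.pieces j, p.2.2 ≤ z) →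
      P ≤ z - (a + s i) := by
    intro z hz hend
    have := aux_pack ((univ.filter (fun j => cl j = i)).sigma (fun j => σ.pieces j))
      (fun k => k.2.2.1) (fun k => k.2.2.2) (a + s i) z hz ?_ ?_
    · rw [Finset.sum_sigma, Finset.sum_congr rfl (fun j _ => σ.pieces_sum j), ← hP] at this
      exact this
    · rintro ⟨j, p⟩ hk
      simp only [Finset.mem_sigma, Finset.mem_filter, Finset.mem_univ, true_and] at hk
      exact ⟨hst j hk.1 p hk.2, (σ.pieces_bounds j p hk.2).2.1, hend j hk.1 p hk.2⟩
    · rintro ⟨j, p⟩ hk ⟨j', p'⟩ hk' hne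
      simp only [Finset.mem_sigma, Finset.mem_filter, Finset.mem_univ, true_and] at hk hk'
      apply σ.machine_pieces_disjoint j j' p hk.2 p' hk'.2
        ((hall j hk.1 p hk.2).trans (hall j' hk'.1 p' hk'.2).symm)
      by_contra hcon
      push Not at hcon
      exact hne (by rw [hcon.1, hcon.2])
  rcases hd with h | h
  · left
    have := pack T hb.2 (fun j hj p hp => (σ.pieces_bounds j p hp).2.2)
    linarith
  · right
    have := pack x h ?_
    · linarith
    · intro j hj p hp
      rcases hsep j hj p hp with h1 | h1
      · exact h1
      · exact absurd ⟨by linarith, by linarith⟩ (hbef j hj p hp)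

/-- The wrapped length is at most the cheap load outside `Sm`. -/
theorem aux_L {υ γ ι : Type*} [Fintype υ] [Fintype γ] [Fintype ι]
    {cl : ι → γ} {t : ι → ℝ} {s : γ → ℝ} {T : ℝ} (hs : ∀ i, 0 < s i)
    (σ : PSchedule υ cl t s T) (Ch : γ → Prop) (Sm : Finset υ) (r : ι → ℝ)
    (hr : ∀ j, r j = if Ch (cl j) then
      ∑ p ∈ (σ.pieces j).filter (fun p => p.1 ∉ Sm), (p.2.2 - p.2.1) else 0)
    (R : γ → ℝ) (hR : ∀ c, R c = ∑ j ∈ univ.filter (fun j => cl j = c), r j) :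
    (∀ c, 0 < R c → Ch c) ∧
    ∑ c ∈ univ.filter (fun c => 0 < R c), (s c + R c) ≤ ∑ u ∈ univ \ Sm, cLoad σ Ch u := by
  have hr0 : ∀ j, 0 ≤ r j := by
    intro j
    rw [hr]
    split_ifs
    · apply Finset.sum_nonneg; intro p hp
      have := σ.pieces_bounds j p (Finset.mem_filter.1 hp).1
      linarith
    · exact le_rfl
  have hR0 : ∀ c, 0 ≤ R c := fun c => by
    rw [hR]; exact Finset.sum_nonneg (fun j _ => hr0 j)
  have hex : ∀ c, 0 < R c → Ch c ∧ ∃ u a, u ∉ Sm ∧ (c, a) ∈ σ.setups u := by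
    intro c hc
    rw [hR] at hc
    obtain ⟨j, hj, hj2⟩ := Finset.exists_ne_zero_of_sum_ne_zero hc.ne'
    have hjc := (Finset.mem_filter.1 hj).2
    rw [hr, hjc] at hj2
    split_ifs at hj2 with hch
    · obtain ⟨p, hp, _⟩ := Finset.exists_ne_zero_of_sum_ne_zero hj2
      rw [Finset.mem_filter] at hp
      obtain ⟨a, ha, _⟩ := σ.setup_before j p hp.1
      rw [hjc] at ha
      exact ⟨hch, p.1, a, hp.2, ha⟩
    · exact absurd rfl hj2
  refine ⟨fun c hc => (hex c hc).1, ?_⟩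
  unfold cLoad
  rw [Finset.sum_add_distrib, Finset.sum_add_distrib, add_comm]
  apply add_le_add
  · calc ∑ c ∈ univ.filter (fun c => 0 < R c), R c ≤ ∑ c, R c :=
          Finset.sum_le_sum_of_subset_of_nonneg (Finset.filter_subset _ _) (fun c _ _ => hR0 c)
      _ = ∑ j, r j := by
          rw [Finset.sum_congr rfl (fun c _ => hR c)]
          exact Finset.sum_fiberwise univ cl r
      _ = _ := by
          rw [Finset.sum_comm, Finset.sum_filter]
          apply Finset.sum_congr rfl
          intro j _
          rw [hr]
          split_ifs
          · rw [← Finset.sum_fiberwise_of_maps_to (s := (σ.pieces j).filter (fun p => p.1 ∉ Sm))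
              (t := univ \ Sm) (g := fun p => p.1)]
            · apply Finset.sum_congr rfl
              intro u hu
              apply Finset.sum_congr _ (fun _ _ => rfl)
              ext p
              simp only [Finset.mem_filter, Finset.mem_sdiff, Finset.mem_univ, true_and] at hu ⊢
              constructor
              · rintro ⟨⟨h1, h2⟩, h3⟩; exact ⟨h1, h3⟩
              · rintro ⟨h1, h3⟩; exact ⟨⟨h1, by rw [h3]; exact hu⟩, h3⟩
            · intro p hp
              simp only [Finset.mem_filter] at hp
              simp [hp.2]
          · rfl
  · rw [Finset.sum_sigma', ← Finset.sum_fiberwise _ (fun z : (Σ _ : υ, γ × ℝ) => z.2.1)]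
    refine le_trans ?_ (Finset.sum_le_sum_of_subset_of_nonneg
      (Finset.filter_subset (fun c => 0 < R c) _) ?_)
    · apply Finset.sum_le_sum
      intro c hc
      obtain ⟨hch, u, a, h1, h2⟩ := hex c (Finset.mem_filter.1 hc).2
      refine Finset.single_le_sum (f := fun z : (Σ _ : υ, γ × ℝ) => s z.2.1)
        (fun z _ => (hs z.2.1).le) (a := ⟨u, (c, a)⟩) ?_
      simp [h1, h2, hch]
    · intro c _ _
      exact Finset.sum_nonneg (fun z _ => (hs z.2.1).le)

/-- Enumeration of the wrap machines. -/
theorem aux_enum {υ γ : Type*} (F : Finset υ) (T L : ℝ) (W : Finset γ) (ua : γ → υ)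
    (hW : W.card ≤ 1) (g : γ → ℝ) (hg : ∀ w ∈ W, g w ≤ T) (hWF : ∀ w ∈ W, ua w ∉ F)
    (hL : L ≤ F.card * T + ∑ w ∈ W, g w) :
    ∃ (m : ℕ) (e : Fin m → υ), Function.Injective e ∧ L ≤ m * T ∧
      ∀ f : Fin m, e f ∈ F ∨ ∃ w ∈ W, e f = ua w ∧ L - (f : ℕ) * T ≤ g w := by
  let e0 : Fin F.card → υ := fun f => (F.equivFin.symm f : υ)
  have he0 : Function.Injective e0 := fun a b h => by
    have := Subtype.ext h
    exact F.equivFin.symm.injective this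
  have he0F : ∀ f, e0 f ∈ F := fun f => (F.equivFin.symm f).2
  rcases Nat.le_one_iff_eq_zero_or_eq_one.1 hW with h | h
  · rw [Finset.card_eq_zero] at h
    subst h
    refine ⟨F.card, e0, he0, by simpa using hL, fun f => Or.inl (he0F f)⟩
  · obtain ⟨w, rfl⟩ := Finset.card_eq_one.1 h
    rw [Finset.sum_singleton] at hL
    have hgw := hg w (by simp)
    have hwF := hWF w (by simp)
    refine ⟨F.card + 1, Fin.snoc (α := fun _ => υ) e0 (ua w), ?_, ?_, ?_⟩
    · apply Fin.snoc_injective_of_injective he0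
      rintro ⟨f, hf⟩
      exact hwF (hf ▸ he0F f)
    · push_cast; linarith
    · intro f
      refine Fin.lastCases ?_ (fun f => ?_) f
      · right
        refine ⟨w, by simp, by simp, ?_⟩
        simp only [Fin.val_last]
        linarith
      · left
        simp only [Fin.snoc_castSucc]
        exact he0F f

/-- Summation over the machines, class by class. -/
theorem aux_count {υ γ : Type*} [Fintype υ] (E : Finset γ) (M : γ → Finset υ)
    (hM : ∀ i ∈ E, ∀ i' ∈ E, ∀ u, u ∈ M i → u ∈ M i' → i = i') (φ : υ → ℝ) (b : γ → ℝ)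
    (h1 : ∀ i ∈ E, ∑ u ∈ M i, φ u ≤ b i) (h2 : ∀ u, (∀ i ∈ E, u ∉ M i) → φ u ≤ 0) :
    ∑ u, φ u ≤ ∑ i ∈ E, b i := by
  have e : ∑ u ∈ E.biUnion M, φ u = ∑ i ∈ E, ∑ u ∈ M i, φ u := by
    apply Finset.sum_biUnion
    intro i hi i' hi' hne
    rw [Function.onFun, Finset.disjoint_left]
    intro u hu hu'
    exact hne (hM i hi i' hi' u hu hu')
  have e2 : ∑ u ∈ univ \ E.biUnion M, φ u ≤ 0 := by
    apply Finset.sum_nonpos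
    intro u hu
    apply h2
    simpa using hu
  have e3 := Finset.sum_sdiff (f := φ) (Finset.subset_univ (E.biUnion M))
  have e4 := Finset.sum_le_sum h1
  linarith

/-- The surplus of the low classes. -/
theorem aux_low {γ : Type*} (Z H W : Finset γ) (hHZ : H ⊆ Z) (hWH : W ⊆ H)
    (hc : H.card = (Z \ H).card + W.card) (g : γ → ℝ) (T : ℝ) (hg : ∀ i ∈ Z, g i ≤ T / 2) :
    ∑ i ∈ Z, (if i ∈ H then g i else g i - T) ≤ ∑ w ∈ W, g w := by
  rw [← Finset.sum_sdiff hHZ, ← Finset.sum_sdiff hWH]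
  have a1 : ∑ i ∈ Z \ H, (if i ∈ H then g i else g i - T) ≤ (Z \ H).card * (- (T / 2)) := by
    rw [← nsmul_eq_mul]
    apply Finset.sum_le_card_nsmul
    intro i hi
    rw [Finset.mem_sdiff] at hi
    rw [if_neg hi.2]
    linarith [hg i hi.1]
  have a2 : ∑ i ∈ H \ W, (if i ∈ H then g i else g i - T) ≤ (H \ W).card * (T / 2) := by
    rw [← nsmul_eq_mul]
    apply Finset.sum_le_card_nsmul
    intro i hi
    rw [Finset.mem_sdiff] at hi
    rw [if_pos hi.1]
    exact hg i (hHZ hi.1)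
  have a3 : ∑ i ∈ W, (if i ∈ H then g i else g i - T) = ∑ w ∈ W, g w :=
    Finset.sum_congr rfl (fun i hi => if_pos (hWH hi))
  have a4 : (H \ W).card = (Z \ H).card := by
    have := Finset.card_sdiff_add_card_eq_card hWH
    omega
  rw [a4] at a2
  linarith

theorem aux_cLoad_le {υ γ ι : Type*} [Fintype υ] [Fintype γ] [Fintype ι]
    {cl : ι → γ} {t : ι → ℝ} {s : γ → ℝ} {T : ℝ} (hT : 0 ≤ T) (hs : ∀ i, 0 < s i)
    (σ : PSchedule υ cl t s T) (Ch : γ → Prop) (u : υ) : cLoad σ Ch u ≤ T := by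
  refine le_trans ?_ (aux_load hT hs σ u)
  unfold cLoad pLoad
  apply add_le_add
  · apply Finset.sum_le_sum_of_subset_of_nonneg (Finset.filter_subset _ _)
    intro j _ _
    apply Finset.sum_nonneg; intro p hp
    have := σ.pieces_bounds j p (Finset.mem_filter.1 hp).1
    linarith
  · exact Finset.sum_le_sum_of_subset_of_nonneg (Finset.filter_subset _ _)
      (fun q _ _ => (hs q.1).le)

theorem aux_ar1 (k T s P X : ℝ) (hk : 2 ≤ k) (hs : T / 2 < s) (hP : 0 < P) (hT : 0 < T)
    (h : X ≤ k * (T - s) - P) : X - (k - 1) * T ≤ 0 := by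
  nlinarith

theorem aux_ar2 (k T s P X : ℝ) (hk : 1 ≤ k) (hs : 0 < s)
    (h : X ≤ k * (T - s) - P) : X - (k - 1) * T ≤ T - s - P := by
  nlinarith

theorem aux_ar3 (k T s P X : ℝ) (hk : 1 ≤ k) (hs : 0 < s)
    (h : X ≤ k * (T - s) - P) : X - (k - 0) * T ≤ T - s - P - T := by
  nlinarith

theorem aux_ar4 (d w T s P X : ℝ) (q5 : w ≤ 1) (q7 : 0 ≤ d) (hs : T / 2 < s)
    (hsT : s ≤ T) (hP : T ≤ s + P)
    (h : X ≤ (2 * d + w) * (T - s) - P) : X - d * T ≤ 0 := by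
  nlinarith [mul_nonneg q7 (sub_nonneg.2 hs.le), mul_nonneg (sub_nonneg.2 q5) (sub_nonneg.2 hsT)]

set_option maxHeartbeats 1000000

/-- Lemma B.1, soundness of large machines: if a feasible preemptive schedule with makespan
at most `T` exists, then there is a feasible preemptive schedule with makespan at most
`(3/2)·T` in which every class `i ∈ I_exp^0 = {i : s_i > T/2 ∧ 3T/4 < s_i + P(C_i) < T}`
is scheduled entirely on its own machine `u_i` (distinct machines for distinct classes)
whose load satisfies `s_i + P(C_i) ≤ load(u_i) ≤ T`. -/
theorem pmtn_large_machines_sound {υ γ ι : Type*} [Fintype υ] [Fintype γ] [Fintype ι]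
    (cl : ι → γ) (t : ι → ℝ) (s : γ → ℝ)
    (ht : ∀ j, 0 < t j) (hs : ∀ i, 0 < s i)
    (hcl : ∀ i : γ, ∃ j, cl j = i)
    (T : ℝ) (hT : 0 < T)
    (P : γ → ℝ) (hP : ∀ i, P i = ∑ j ∈ univ.filter (fun j => cl j = i), t j)
    (Iexp0 : Finset γ)
    (hIexp0 : Iexp0 = univ.filter (fun i =>
      T / 2 < s i ∧ 3 / 4 * T < s i + P i ∧ s i + P i < T))
    (σ : PSchedule υ cl t s T) :
    ∃ σ' : PSchedule υ cl t s (3 / 2 * T), ∃ uassign : γ → υ,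
      (∀ i₁ ∈ Iexp0, ∀ i₂ ∈ Iexp0, uassign i₁ = uassign i₂ → i₁ = i₂) ∧
      (∀ i ∈ Iexp0,
        (∀ j : ι, cl j = i → ∀ p ∈ σ'.pieces j, p.1 = uassign i) ∧
        s i + P i ≤ pLoad σ' (uassign i) ∧ pLoad σ' (uassign i) ≤ T) := by

  have hP0 : ∀ i, 0 < P i := by
    intro i
    rw [hP]
    obtain ⟨j, hj⟩ := hcl i
    exact Finset.sum_pos (fun j _ => ht j) ⟨j, by simp [hj]⟩
  obtain ⟨MM, hMM⟩ : ∃ MM : γ → Finset υ, ∀ i u, u ∈ MM i ↔ ∃ a, (i, a) ∈ σ.setups u :=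
    ⟨fun i => univ.filter (fun u => ∃ a, (i, a) ∈ σ.setups u), by simp⟩
  have hpM : ∀ j, ∀ p ∈ σ.pieces j, p.1 ∈ MM (cl j) := by
    intro j p hp
    obtain ⟨a, ha, _⟩ := σ.setup_before j p hp
    exact (hMM _ _).2 ⟨a, ha⟩
  have hne : ∀ i, ∃ u, u ∈ MM i := by
    intro i
    obtain ⟨j, hj⟩ := hcl i
    have h1 := σ.pieces_sum j
    have h2 : ∑ p ∈ σ.pieces j, (p.2.2 - p.2.1) ≠ 0 := by rw [h1]; exact (ht j).ne'
    obtain ⟨p, hp, _⟩ := Finset.exists_ne_zero_of_sum_ne_zero h2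
    exact ⟨p.1, hj ▸ hpM j p hp⟩
  choose ua hua using hne
  have hsT : ∀ i, s i ≤ T := by
    intro i
    obtain ⟨a, ha⟩ := (hMM _ _).1 (hua i)
    have := σ.setup_bounds _ _ ha
    simp only at this
    linarith
  have hdisj : ∀ i i', T / 2 < s i → T / 2 < s i' → ∀ u, u ∈ MM i → u ∈ MM i' → i = i' := by
    intro i i' hi hi' u hu hu'
    obtain ⟨a, ha⟩ := (hMM _ _).1 hu
    obtain ⟨a', ha'⟩ := (hMM _ _).1 hu'
    exact congrArg Prod.fst (aux_two σ u _ _ ha ha' hi hi')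
  have huai : ∀ i i', T / 2 < s i → T / 2 < s i' → ua i = ua i' → i = i' := by
    intro i i' hi hi' h
    exact hdisj i i' hi hi' (ua i) (hua i) (h ▸ hua i')
  have hI0 : ∀ i, i ∈ Iexp0 ↔ T / 2 < s i ∧ 3 / 4 * T < s i + P i ∧ s i + P i < T := by
    intro i; rw [hIexp0]; simp
  obtain ⟨Z, hZ⟩ : ∃ Z : Finset γ, ∀ i, i ∈ Z ↔ T / 2 < s i ∧ s i + P i ≤ 3 / 4 * T :=
    ⟨univ.filter (fun i => T / 2 < s i ∧ s i + P i ≤ 3 / 4 * T), by simp⟩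
  obtain ⟨Hi, hHi⟩ : ∃ Hi : Finset γ, ∀ i, i ∈ Hi ↔ T / 2 < s i ∧ T ≤ s i + P i :=
    ⟨univ.filter (fun i => T / 2 < s i ∧ T ≤ s i + P i), by simp⟩
  obtain ⟨E, hE⟩ : ∃ E : Finset γ, ∀ i, i ∈ E ↔ T / 2 < s i :=
    ⟨univ.filter (fun i => T / 2 < s i), by simp⟩
  have hI0Z : ∀ i, i ∈ Iexp0 → i ∉ Z := by
    intro i h h'; rw [hI0] at h; rw [hZ] at h'; linarith
  have hI0Hi : ∀ i, i ∈ Iexp0 → i ∉ Hi := by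
    intro i h h'; rw [hI0] at h; rw [hHi] at h'; linarith
  have hZHi : ∀ i, i ∈ Z → i ∉ Hi := by
    intro i h h'; rw [hZ] at h; rw [hHi] at h'; linarith
  have hcases : ∀ i, T / 2 < s i → i ∈ Iexp0 ∨ i ∈ Z ∨ i ∈ Hi := by
    intro i hi
    rw [hI0, hZ, hHi]
    by_cases h1 : s i + P i ≤ 3 / 4 * T
    · exact Or.inr (Or.inl ⟨hi, h1⟩)
    · by_cases h2 : T ≤ s i + P i
      · exact Or.inr (Or.inr ⟨hi, h2⟩)
      · exact Or.inl ⟨hi, not_le.1 h1, not_le.1 h2⟩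
  obtain ⟨HZ, hHZ, fZ, W, hWH, hf1, hf2, hf3, hW1, hcZ⟩ := aux_pairing _ Z rfl
  have hpair := fun i => aux_pairing _ (MM i) rfl
  choose H hHM f Wm _ hg1 hg2 _ hWm1 hcH using hpair
  have hHZE : ∀ i, i ∈ HZ → T / 2 < s i := fun i h => ((hZ i).1 (hHZ h)).1
  obtain ⟨hb, hhb⟩ : ∃ hb : γ → Finset υ, ∀ i, hb i = if i ∈ Hi then H i else
      if i ∈ Iexp0 ∨ i ∈ HZ then {ua i} else ∅ := ⟨_, fun i => rfl⟩
  have hbM : ∀ i, hb i ⊆ MM i := by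
    intro i
    rw [hhb]
    split_ifs
    · exact hHM i
    · simpa using hua i
    · simp
  obtain ⟨F, hF⟩ : ∃ F : Finset υ, ∀ u, u ∈ F ↔ ∀ i ∈ E, u ∉ hb i :=
    ⟨univ.filter (fun u => ∀ i ∈ E, u ∉ hb i), by simp⟩
  have huaF : ∀ i, i ∈ Iexp0 ∨ i ∈ HZ → ua i ∉ F := by
    intro i hi hiF
    have hiE : T / 2 < s i := hi.elim (fun h => ((hI0 i).1 h).1) (hHZE i)
    have hiH : i ∉ Hi := hi.elim (hI0Hi i) (fun h => hZHi i (hHZ h))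
    have := (hF _).1 hiF i ((hE i).2 hiE)
    rw [hhb, if_neg hiH, if_pos hi] at this
    simp at this
  have hHF : ∀ i ∈ Hi, ∀ u ∈ H i, u ∉ F := by
    intro i hi u hu huF
    have := (hF _).1 huF i ((hE i).2 ((hHi i).1 hi).1)
    rw [hhb, if_pos hi] at this
    exact this hu
  obtain ⟨Sm, hSm⟩ : ∃ Sm : Finset υ, ∀ u, u ∈ Sm ↔ ∃ i ∈ Iexp0, (MM i).card = 1 ∧ ua i = u :=
    ⟨(Iexp0.filter (fun i => (MM i).card = 1)).image ua, by simp [and_assoc]⟩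
  have hMM1 : ∀ i, (MM i).card = 1 → MM i = {ua i} := by
    intro i hi
    obtain ⟨v, hv⟩ := Finset.card_eq_one.1 hi
    have := hua i
    rw [hv, Finset.mem_singleton] at this
    rw [hv, this]
  obtain ⟨Ch, hCh⟩ : ∃ Ch : γ → Prop, ∀ c, Ch c ↔ ¬ T / 2 < s c := ⟨_, fun c => Iff.rfl⟩
  have hgap : ∀ u ∈ Sm, ∃ i a, i ∈ Iexp0 ∧ (i, a) ∈ σ.setups u ∧
      (∀ a', (i, a') ∈ σ.setups u → a' = a) ∧
      (∀ j, cl j = i → ∀ p ∈ σ.pieces j, p.1 = u) := by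
    intro u hu
    obtain ⟨i, hi, hk, rfl⟩ := (hSm u).1 hu
    obtain ⟨a, ha⟩ := (hMM _ _).1 (hua i)
    have hiE := ((hI0 i).1 hi).1
    refine ⟨i, a, hi, ha, ?_, ?_⟩
    · intro a' ha'
      exact congrArg Prod.snd (aux_two σ _ _ _ ha' ha hiE hiE)
    · intro j hj p hp
      have := hpM j p hp
      rw [hj, hMM1 i hk] at this
      simpa using this
  obtain ⟨σ₃, h3p, h3q, h3l⟩ := aux_small hT hs σ Ch Sm
    (by
      intro j hj p hp hpS
      obtain ⟨i, a, hi, ha, hau, hall⟩ := hgap _ hpS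
      have hiI := (hI0 i).1 hi
      have hji : cl j ≠ i := by rintro rfl; exact (hCh _).1 hj hiI.1
      have hb1 := σ.pieces_bounds j p hp
      apply aux_gap σ i (P i) (hP i) hiI.2.1 p.1 a ha hau hall p.2.1 p.2.2 hb1.2.1
      · exact σ.machine_piece_setup_disjoint j p hp _ ha
      · intro j' hj' p' hp'
        refine σ.machine_pieces_disjoint j' j p' hp' p hp (hall j' hj' p' hp') (Or.inl ?_)
        rintro rfl; exact hji hj'
      · intro j' hj' p' hp'
        obtain ⟨a', ha', hle, _, hB⟩ := σ.setup_before j' p' hp'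
        have hu' := hall j' hj' p' hp'
        rw [hu', hj'] at ha'
        have ea := hau a' ha'
        have := hB j (by rw [hj']; exact hji) p hp hu'.symm
        rw [ea, hj'] at this
        exact this)
    (by
      intro u hu q hq hj
      obtain ⟨i, a, hi, ha, hau, hall⟩ := hgap _ hu
      have hiI := (hI0 i).1 hi
      have hji : q.1 ≠ i := by intro e; exact (hCh _).1 hj (by rw [e]; exact hiI.1)
      have hs1 := hs q.1
      apply aux_gap σ i (P i) (hP i) hiI.2.1 u a ha hau hall q.2 (q.2 + s q.1) (by linarith)
      · exact σ.machine_setups_disjoint u q hq _ ha (by rintro rfl; exact hji rfl)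
      · intro j' hj' p' hp'
        have hu' := hall j' hj' p' hp'
        exact σ.machine_piece_setup_disjoint j' p' hp' q (by rw [hu']; exact hq)
      · intro j' hj' p' hp'
        obtain ⟨a', ha', hle, hA, _⟩ := σ.setup_before j' p' hp'
        have hu' := hall j' hj' p' hp'
        rw [hu', hj'] at ha'
        have ea := hau a' ha'
        have := hA q (by rw [hu']; exact hq) (by rw [hj']; exact hji)
        rw [ea, hj'] at this
        exact this)
  obtain ⟨r, hr⟩ : ∃ r : ι → ℝ, ∀ j, r j = if Ch (cl j) then
      ∑ p ∈ (σ.pieces j).filter (fun p => p.1 ∉ Sm), (p.2.2 - p.2.1) else 0 := ⟨_, fun j => rfl⟩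
  obtain ⟨R, hR⟩ : ∃ R : γ → ℝ, ∀ c, R c = ∑ j ∈ univ.filter (fun j => cl j = c), r j :=
    ⟨_, fun c => rfl⟩
  obtain ⟨L, hL⟩ : ∃ L, L = ∑ c ∈ univ.filter (fun c => 0 < R c), (s c + R c) := ⟨_, rfl⟩
  have hlen : ∀ j, ∀ p ∈ σ.pieces j, 0 ≤ p.2.2 - p.2.1 := by
    intro j p hp
    have := σ.pieces_bounds j p hp
    linarith
  have hr0 : ∀ j, 0 ≤ r j := by
    intro j
    rw [hr]
    split_ifs
    · exact Finset.sum_nonneg (fun p hp => hlen j p (Finset.mem_filter.1 hp).1)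
    · exact le_rfl
  have hrT : ∀ j, r j ≤ T := by
    intro j
    rw [hr]
    split_ifs
    · calc _ ≤ ∑ p ∈ σ.pieces j, (p.2.2 - p.2.1) :=
            Finset.sum_le_sum_of_subset_of_nonneg (Finset.filter_subset _ _)
              (fun p hp _ => hlen j p hp)
        _ ≤ T - 0 := aux_pack (σ.pieces j) (fun p => p.2.1) (fun p => p.2.2) 0 T hT.le
              (σ.pieces_bounds j) (σ.pieces_no_parallel j)
        _ = T := by ring
    · exact hT.le
  obtain ⟨hRCh, hLle⟩ := aux_L hs σ Ch Sm r hr R hR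
  rw [← hL] at hLle
  obtain ⟨g, hg⟩ : ∃ g : γ → ℝ, ∀ i, g i = T - s i - P i := ⟨_, fun i => rfl⟩
  have hgT : ∀ i, T / 2 < s i → g i ≤ T / 2 := by
    intro i hi
    rw [hg]; linarith [hP0 i]
  have hcount : L ≤ F.card * T + ∑ w ∈ W, g w := by
    obtain ⟨φ, hφ⟩ : ∃ φ : υ → ℝ, ∀ u, φ u = (if u ∈ Sm then 0 else cLoad σ Ch u) -
        (if u ∈ F then T else 0) := ⟨_, fun u => rfl⟩
    obtain ⟨b, hbdef⟩ : ∃ b : γ → ℝ, ∀ i, b i = if i ∈ Z then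
        (if i ∈ HZ then g i else g i - T) else 0 := ⟨_, fun u => rfl⟩
    have c0 : ∀ u, 0 ≤ cLoad σ Ch u := aux_cLoad_nonneg hs σ Ch
    have key := aux_count E MM
      (fun i hi i' hi' => hdisj i i' ((hE i).1 hi) ((hE i').1 hi')) φ b ?_ ?_
    · have e1 : ∑ u, φ u = ∑ u ∈ univ \ Sm, cLoad σ Ch u - F.card * T := by
        rw [Finset.sum_congr rfl (fun u _ => hφ u), Finset.sum_sub_distrib]
        congr 1
        · have : (univ \ Sm : Finset υ) = univ.filter (fun u => u ∉ Sm) := by ext; simp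
          rw [this, Finset.sum_filter]
          apply Finset.sum_congr rfl
          intro u _
          by_cases h : u ∈ Sm <;> simp [h]
        · rw [← Finset.sum_filter]
          simp
      have e2 : ∑ i ∈ E, b i = ∑ i ∈ Z, (if i ∈ HZ then g i else g i - T) := by
        rw [Finset.sum_congr rfl (fun i _ => hbdef i), ← Finset.sum_filter]
        apply Finset.sum_congr _ (fun _ _ => rfl)
        ext i
        simp only [Finset.mem_filter, hE, hZ]
        tauto
      have e3 := aux_low Z HZ W hHZ hWH hcZ g T (fun i hi => hgT i ((hZ i).1 hi).1)
      linarith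
    · intro i hi
      have hiE := (hE i).1 hi
      have hfil : (MM i).filter (fun u => u ∈ F) = MM i \ hb i := by
        ext u
        simp only [Finset.mem_filter, Finset.mem_sdiff, hF]
        constructor
        · rintro ⟨h1, h2⟩; exact ⟨h1, h2 i hi⟩
        · rintro ⟨h1, h2⟩
          refine ⟨h1, fun i' hi' h3 => ?_⟩
          have := hdisj i i' hiE ((hE i').1 hi') u h1 (hbM i' h3)
          exact h2 (this ▸ h3)
      have e1 : ∑ u ∈ MM i, φ u = ∑ u ∈ MM i, (if u ∈ Sm then 0 else cLoad σ Ch u) -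
          (MM i \ hb i).card * T := by
        rw [Finset.sum_congr rfl (fun u _ => hφ u), Finset.sum_sub_distrib, ← hfil]
        congr 1
        rw [← Finset.sum_filter]
        simp
      have e2 : ∑ u ∈ MM i, (if u ∈ Sm then 0 else cLoad σ Ch u) ≤
          (MM i).card * (T - s i) - P i := by
        refine le_trans (Finset.sum_le_sum (fun u _ => ?_)) (aux_cLoad_sum hT.le hs σ Ch i
          (fun h => (hCh i).1 h hiE) (P i) (hP i) (MM i) (hMM i))
        split_ifs
        · exact c0 u
        · exact le_rfl
      have hk1 : 1 ≤ (MM i).card := Finset.card_pos.2 ⟨ua i, hua i⟩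
      have hk1' : (1 : ℝ) ≤ ((MM i).card : ℝ) := by exact_mod_cast hk1
      have hcard : ((MM i \ hb i).card : ℝ) = (MM i).card - (hb i).card := by
        have := Finset.card_sdiff_add_card_eq_card (hbM i)
        rw [← this]; push_cast; ring
      have hsi := hs i
      have hPi := hP0 i
      have hsTi := hsT i
      rw [e1, hbdef]
      rcases hcases i hiE with hc | hc | hc
      · have hc' := (hI0 i).1 hc
        rw [if_neg (hI0Z i hc)]
        by_cases hone : (MM i).card = 1
        · have : ∑ u ∈ MM i, (if u ∈ Sm then 0 else cLoad σ Ch u) = 0 := by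
            rw [hMM1 i hone, Finset.sum_singleton, if_pos ((hSm _).2 ⟨i, hc, hone, rfl⟩)]
          rw [this]
          have : (0 : ℝ) ≤ ((MM i \ hb i).card : ℝ) * T := mul_nonneg (Nat.cast_nonneg _) hT.le
          linarith
        · have hk2 : 2 ≤ (MM i).card := by omega
          have hk2' : (2 : ℝ) ≤ ((MM i).card : ℝ) := by exact_mod_cast hk2
          have : hb i = {ua i} := by rw [hhb, if_neg (hI0Hi i hc), if_pos (Or.inl hc)]
          rw [hcard, this, Finset.card_singleton, Nat.cast_one]
          exact aux_ar1 _ _ _ _ _ hk2' hiE hPi hT e2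
      · rw [if_pos hc]
        have hnH := hZHi i hc
        have hnI : i ∉ Iexp0 := fun h => hI0Z i h hc
        by_cases hz : i ∈ HZ
        · rw [if_pos hz, hg]
          have : hb i = {ua i} := by rw [hhb, if_neg hnH, if_pos (Or.inr hz)]
          rw [hcard, this, Finset.card_singleton, Nat.cast_one]
          exact aux_ar2 _ _ _ _ _ hk1' hsi e2
        · rw [if_neg hz, hg]
          have : hb i = ∅ := by rw [hhb, if_neg hnH, if_neg (by tauto)]
          rw [hcard, this, Finset.card_empty, Nat.cast_zero]
          exact aux_ar3 _ _ _ _ _ hk1' hsi e2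
      · rw [if_neg (fun h => hZHi i h hc)]
        have hc' := (hHi i).1 hc
        have : hb i = H i := by rw [hhb, if_pos hc]
        rw [this]
        have q1 := hcH i
        have q2 := hWm1 i
        have q3 := Finset.card_sdiff_add_card_eq_card (hHM i)
        have q4 : ((MM i).card : ℝ) = 2 * ((MM i \ H i).card : ℝ) + ((Wm i).card : ℝ) := by
          have : (MM i).card = 2 * (MM i \ H i).card + (Wm i).card := by omega
          exact_mod_cast this
        have q5 : ((Wm i).card : ℝ) ≤ 1 := by exact_mod_cast q2
        have q7 : (0 : ℝ) ≤ ((MM i \ H i).card : ℝ) := Nat.cast_nonneg _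
        rw [q4] at e2
        exact aux_ar4 _ _ _ _ _ _ q5 q7 hiE hsTi hc'.2 e2
    · intro u hu
      rw [hφ]
      have huF : u ∈ F := (hF u).2 (fun i hi h => hu i hi (hbM i h))
      rw [if_pos huF]
      have := aux_cLoad_le hT.le hs σ Ch u
      split_ifs <;> linarith
  obtain ⟨m, e, he, hLm, hef⟩ := aux_enum F T L W ua hW1 g
    (fun w hw => by linarith [hgT w (hHZE w (hWH hw))])
    (fun w hw => huaF w (Or.inr (hWH hw))) hcount
  obtain ⟨σ₄, h4p, h4q⟩ := aux_wrap cl r s T hT hs hr0 hrT R hR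
    (fun c hc => not_lt.1 ((hCh c).1 (hRCh c hc))) L hL m hLm e he
  obtain ⟨Q, hQ⟩ : ∃ Q : Finset γ, ∀ i, i ∈ Q ↔ i ∈ Iexp0 ∨ i ∈ Z :=
    ⟨Iexp0 ∪ Z, by simp⟩
  have hQE : ∀ i ∈ Q, T / 2 < s i := by
    intro i hi
    rcases (hQ i).1 hi with h | h
    · exact ((hI0 i).1 h).1
    · exact ((hZ i).1 h).1
  have hQHi : ∀ i ∈ Q, i ∉ Hi := by
    intro i hi
    rcases (hQ i).1 hi with h | h
    · exact hI0Hi i h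
    · exact hZHi i h
  obtain ⟨kk, hkk⟩ : ∃ kk : γ → γ, ∀ i, kk i = if i ∈ Iexp0 ∨ i ∈ HZ then i else fZ i :=
    ⟨_, fun i => rfl⟩
  obtain ⟨τ, hτ⟩ : ∃ τ : γ → ℝ, ∀ i, τ i = if i ∈ Iexp0 then T / 2 else
      if i ∈ HZ then 3 / 2 * T - s i - P i else 0 := ⟨_, fun i => rfl⟩
  have hQc : ∀ i ∈ Q, (i ∈ Iexp0 ∧ kk i = i ∧ τ i = T / 2) ∨
      (i ∈ HZ ∧ kk i = i ∧ τ i = 3 / 2 * T - s i - P i) ∨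
      (i ∈ Z \ HZ ∧ kk i = fZ i ∧ τ i = 0) := by
    intro i hi
    by_cases h1 : i ∈ Iexp0
    · left; exact ⟨h1, by rw [hkk, if_pos (Or.inl h1)], by rw [hτ, if_pos h1]⟩
    · by_cases h2 : i ∈ HZ
      · right; left
        exact ⟨h2, by rw [hkk, if_pos (Or.inr h2)], by rw [hτ, if_neg h1, if_pos h2]⟩
      · right; right
        have h3 : i ∈ Z := ((hQ i).1 hi).resolve_left h1
        exact ⟨Finset.mem_sdiff.2 ⟨h3, h2⟩, by rw [hkk, if_neg (by tauto)],
          by rw [hτ, if_neg h1, if_neg h2]⟩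
  have hkk1 : ∀ i ∈ Q, kk i ∈ Iexp0 ∨ kk i ∈ HZ := by
    intro i hi
    rcases hQc i hi with ⟨h, h', _⟩ | ⟨h, h', _⟩ | ⟨h, h', _⟩
    · left; rw [h']; exact h
    · right; rw [h']; exact h
    · right; rw [h']; exact hf1 i h
  have hkE : ∀ k, k ∈ Iexp0 ∨ k ∈ HZ → T / 2 < s k := by
    intro k hk
    exact hk.elim (fun h => ((hI0 k).1 h).1) (hHZE k)
  have hkI : ∀ i ∈ Q, kk i ∈ Iexp0 → i = kk i := by
    intro i hi hk
    rcases hQc i hi with ⟨h, h', _⟩ | ⟨h, h', _⟩ | ⟨h, h', _⟩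
    · exact h'.symm
    · exact h'.symm
    · rw [h'] at hk
      exact absurd (hHZ (hf1 i h)) (hI0Z _ hk)
  have hkW : ∀ i ∈ Q, kk i ∈ W → i = kk i := by
    intro i hi hk
    rcases hQc i hi with ⟨h, h', _⟩ | ⟨h, h', _⟩ | ⟨h, h', _⟩
    · exact h'.symm
    · exact h'.symm
    · rw [h'] at hk
      exact absurd hk (hf3 i h)
  obtain ⟨σ₁, h1p, h1q, h1l⟩ := aux_seq cl t s (3 / 2 * T) ht hs P hP Q (fun i => ua (kk i)) τ
    (by
      intro i hi
      have hsi := hs i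
      have hPi := hP0 i
      rcases hQc i hi with ⟨h, _, h'⟩ | ⟨h, _, h'⟩ | ⟨h, _, h'⟩ <;> rw [h']
      · have := (hI0 i).1 h
        constructor <;> linarith
      · have := (hZ i).1 (hHZ h)
        constructor <;> linarith
      · have := (hZ i).1 (Finset.mem_sdiff.1 h).1
        constructor <;> linarith)
    (by
      intro i hi i' hi' hne heq
      have hk := huai _ _ (hkE _ (hkk1 i hi)) (hkE _ (hkk1 i' hi')) heq
      have hmix : ∀ i i', i ∈ HZ → i' ∈ Z \ HZ → τ i = 3 / 2 * T - s i - P i → τ i' = 0 →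
          τ i' + s i' + P i' ≤ τ i := by
        intro i i' h h' e1 e2
        have := (hZ i).1 (hHZ h)
        have := (hZ i').1 (Finset.mem_sdiff.1 h').1
        rw [e1, e2]; linarith
      rcases hQc i hi with ⟨h, h1, h2⟩ | ⟨h, h1, h2⟩ | ⟨h, h1, h2⟩ <;>
        rcases hQc i' hi' with ⟨h', h1', h2'⟩ | ⟨h', h1', h2'⟩ | ⟨h', h1', h2'⟩
      · exact absurd (by rw [← h1, ← h1', hk]) hne
      · exact absurd (by rw [← h1, ← h1', hk]) hne
      · rw [h1, h1'] at hk
        exact absurd (hHZ (hf1 i' h')) (hk ▸ hI0Z i h)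
      · exact absurd (by rw [← h1, ← h1', hk]) hne
      · exact absurd (by rw [← h1, ← h1', hk]) hne
      · right; exact hmix i i' h h' h2 h2'
      · rw [h1, h1'] at hk
        exact absurd (hHZ (hf1 i h)) (hk ▸ hI0Z i' h')
      · left; exact hmix i' i h' h h2' h2
      · rw [h1, h1'] at hk
        exact absurd (hf2 i h i' h' hk) hne)
  obtain ⟨σ₂, h2p, h2q⟩ := aux_high hT hs σ Hi (fun i hi => ((hHi i).1 hi).1) (fun i _ => hsT i) H
    (fun i u => if u ∈ H i then u else f i u) (fun i u => if u ∈ H i then 0 else T / 2)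
    (by
      intro i hi u hu
      show (if u ∈ H i then u else f i u) ∈ H i
      split_ifs with h
      · exact h
      · exact hg1 i u (Finset.mem_sdiff.2 ⟨(hMM i u).2 hu, h⟩))
    (by
      intro i hi u
      show (if u ∈ H i then (0 : ℝ) else T / 2) = 0 ∨ (if u ∈ H i then (0 : ℝ) else T / 2) = T / 2
      split_ifs
      · left; rfl
      · right; rfl)
    (by
      intro i hi u hu v hv heq
      by_cases h1 : u ∈ H i <;> by_cases h2 : v ∈ H i
      · left; simpa [h1, h2] using heq
      · right; simp only [h1, h2, if_true, if_false]; linarith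
      · right; simp only [h1, h2, if_true, if_false]; linarith
      · left
        simp only [h1, h2, if_false] at heq
        exact hg2 i u (Finset.mem_sdiff.2 ⟨(hMM i u).2 hu, h1⟩) v
          (Finset.mem_sdiff.2 ⟨(hMM i v).2 hv, h2⟩) heq)
    (by
      intro i hi i' hi' u hu hu'
      exact hdisj i i' ((hHi i).1 hi).1 ((hHi i').1 hi').1 u (hHM i hu) (hHM i' hu'))
  have h1m : ∀ i ∈ Q, ∀ i' ∈ Hi, ua (kk i) ∉ H i' := by
    intro i hi i' hi' h
    have hk := hkk1 i hi
    have := hdisj _ _ (hkE _ hk) ((hHi i').1 hi').1 _ (hua (kk i)) (hHM i' h)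
    rw [← this] at hi'
    exact hk.elim (fun h => hI0Hi _ h hi') (fun h => hZHi _ (hHZ h) hi')
  have hfS : ∀ f', e f' ∉ Sm := by
    intro f' hS
    obtain ⟨i, hi, _, hu⟩ := (hSm _).1 hS
    rcases hef f' with h | ⟨w, hw, h, _⟩
    · exact huaF i (Or.inl hi) (hu ▸ h)
    · have := huai i w (hkE i (Or.inl hi)) (hHZE w (hWH hw)) (hu.trans h)
      exact hI0Z i hi (this ▸ hHZ (hWH hw))
  have hHua : ∀ i ∈ Hi, ∀ k, k ∈ Iexp0 ∨ k ∈ HZ → ua k ∉ H i := by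
    intro i' hi' k hk h
    have := hdisj _ _ (hkE _ hk) ((hHi i').1 hi').1 _ (hua k) (hHM i' h)
    rw [← this] at hi'
    exact hk.elim (fun h => hI0Hi _ h hi') (fun h => hZHi _ (hHZ h) hi')
  obtain ⟨σA, hAp, hAq, hAl⟩ := aux_union hs σ₁ σ₂ _ (fun j => rfl)
    (by
      intro j p hp q hq
      exact absurd (h2p j q hq).1 (hQHi _ (h1p j p hp).1))
    (by
      intro u
      refine ⟨0, ?_⟩
      by_cases hu : ∃ i ∈ Hi, u ∈ H i
      · obtain ⟨i, hi, hui⟩ := hu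
        left
        refine ⟨?_, ?_, fun j p hp _ => (σ₂.pieces_bounds j p hp).1,
          fun q hq => (σ₂.setup_bounds u q hq).1⟩
        · intro j p hp hpu
          have := h1p j p hp
          rw [← hpu, this.2.1] at hui
          exact absurd hui (h1m _ this.1 i hi)
        · intro q hq
          have := h1q u q hq
          rw [← this.2.1] at hui
          exact absurd hui (h1m _ this.1 i hi)
      · right
        refine ⟨?_, ?_, fun j p hp _ => (σ₁.pieces_bounds j p hp).1,
          fun q hq => (σ₁.setup_bounds u q hq).1⟩
        · intro j p hp hpu
          have := h2p j p hp
          exact absurd ⟨_, this.1, hpu ▸ this.2⟩ hu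
        · intro q hq
          have := h2q u q hq
          exact absurd ⟨_, this.1, this.2⟩ hu)
  obtain ⟨σB, hBp, hBq, hBl⟩ := aux_union hs σ₃ σ₄ _ (fun j => rfl)
    (by
      intro j p hp q hq
      obtain ⟨_, f', _, h1, _⟩ := h4p j q hq
      left
      exact le_trans (h3p j p hp).2.2 h1)
    (by
      intro u
      refine ⟨0, ?_⟩
      by_cases hu : u ∈ Sm
      · right
        refine ⟨?_, ?_, fun j p hp _ => (σ₃.pieces_bounds j p hp).1,
          fun q hq => (σ₃.setup_bounds u q hq).1⟩
        · intro j p hp hpu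
          obtain ⟨_, f', h1, _⟩ := h4p j p hp
          exact absurd (by rw [← h1, hpu]; exact hu) (hfS f')
        · intro q hq
          obtain ⟨_, f', h1, _⟩ := h4q u q hq
          exact absurd (by rw [← h1]; exact hu) (hfS f')
      · left
        refine ⟨?_, ?_, fun j p hp _ => (σ₄.pieces_bounds j p hp).1,
          fun q hq => (σ₄.setup_bounds u q hq).1⟩
        · intro j p hp hpu
          exact absurd (hpu ▸ (h3p j p hp).2.1) hu
        · intro q hq
          exact absurd (h3q u q hq).2.1 hu)
  have hAE : ∀ j, ∀ p ∈ σA.pieces j, T / 2 < s (cl j) := by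
    intro j p hp
    rcases (hAp j p).1 hp with h | h
    · exact hQE _ (h1p j p h).1
    · exact ((hHi _).1 (h2p j p h).1).1
  have hBE : ∀ j, ∀ p ∈ σB.pieces j, ¬ T / 2 < s (cl j) := by
    intro j p hp
    rcases (hBp j p).1 hp with h | h
    · exact (hCh _).1 (h3p j p h).1
    · exact (hCh _).1 (hRCh _ (h4p j p h).1)
  have hAua : ∀ k, k ∈ Iexp0 ∨ k ∈ W →
      (∀ j, ∀ p ∈ σA.pieces j, p.1 = ua k → τ k ≤ p.2.1) ∧
      (∀ q ∈ σA.setups (ua k), τ k ≤ q.2) := by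
    intro k hk
    have hk' : k ∈ Iexp0 ∨ k ∈ HZ := hk.imp id (fun h => hWH h)
    have hcl : ∀ i ∈ Q, ua (kk i) = ua k → i = k := by
      intro i hi h
      have h2 := huai _ _ (hkE _ (hkk1 i hi)) (hkE _ hk') h
      rw [← h2] at hk
      exact (hk.elim (hkI i hi) (hkW i hi)).trans h2
    constructor
    · intro j p hp hpu
      rcases (hAp j p).1 hp with h | h
      · have h1 := h1p j p h
        have := hcl _ h1.1 (h1.2.1.symm.trans hpu)
        rw [← this]
        exact h1.2.2.1
      · have h1 := h2p j p h
        exact absurd (hpu ▸ h1.2) (hHua _ h1.1 k hk')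
    · intro q hq
      rcases (hAq _ q).1 hq with h | h
      · have h1 := h1q _ q h
        have := hcl _ h1.1 h1.2.1
        rw [← this]
        exact h1.2.2.ge
      · have h1 := h2q _ q h
        exact absurd h1.2 (hHua _ h1.1 k hk')
  obtain ⟨σ', hp', hq', hl'⟩ := aux_union hs σA σB t
    (by
      intro j
      by_cases hE' : T / 2 < s (cl j)
      · have hnc : ¬ Ch (cl j) := fun h => (hCh _).1 h hE'
        rw [hr]
        simp only [if_neg hnc]
        by_cases hq : cl j ∈ Q
        · simp only [if_pos hq, if_neg (hQHi _ hq)]; ring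
        · have : cl j ∈ Hi := by
            rcases hcases _ hE' with h | h | h
            · exact absurd ((hQ _).2 (Or.inl h)) hq
            · exact absurd ((hQ _).2 (Or.inr h)) hq
            · exact h
          simp only [if_neg hq, if_pos this]; ring
      · have hc : Ch (cl j) := (hCh _).2 hE'
        have hq : cl j ∉ Q := fun h => hE' (hQE _ h)
        have hh : cl j ∉ Hi := fun h => hE' ((hHi _).1 h).1
        rw [hr]
        simp only [if_pos hc, if_neg hq, if_neg hh]
        rw [Finset.sum_filter_add_sum_filter_not, σ.pieces_sum j]
        ring)
    (by
      intro j p hp q hq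
      exact absurd (hAE j p hp) (hBE j q hq))
    (by
      intro u
      by_cases hS : u ∈ Sm
      · obtain ⟨i, hi, _, rfl⟩ := (hSm u).1 hS
        refine ⟨T / 2, Or.inr ⟨?_, ?_, ?_, ?_⟩⟩
        · intro j p hp hpu
          rcases (hBp j p).1 hp with h | h
          · exact (h3p j p h).2.2
          · obtain ⟨_, f', h1, _⟩ := h4p j p h
            exact absurd (by rw [← h1, hpu]; exact hS) (hfS f')
        · intro q hq
          rcases (hBq _ q).1 hq with h | h
          · exact (h3q _ q h).2.2
          · obtain ⟨_, f', h1, _⟩ := h4q _ q h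
            exact absurd (by rw [← h1]; exact hS) (hfS f')
        · intro j p hp hpu
          have := (hAua i (Or.inl hi)).1 j p hp hpu
          rwa [hτ, if_pos hi] at this
        · intro q hq
          have := (hAua i (Or.inl hi)).2 q hq
          rwa [hτ, if_pos hi] at this
      · by_cases hW' : ∃ w ∈ W, ua w = u
        · obtain ⟨w, hw, rfl⟩ := hW'
          have hwE := hHZE w (hWH hw)
          have hτw : τ w = T / 2 + g w := by
            rw [hτ, if_neg (fun h => hI0Z w h (hHZ (hWH hw))), if_pos (hWH hw), hg]; ring
          have hend : ∀ f', e f' = ua w → T / 2 + L - ((f' : ℕ) : ℝ) * T ≤ τ w := by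
            intro f' h
            rcases hef f' with h1 | ⟨w', hw', h1, h2⟩
            · rw [h] at h1
              exact absurd h1 (huaF w (Or.inr (hWH hw)))
            · have := huai w' w (hHZE w' (hWH hw')) hwE (h1.symm.trans h)
              rw [this] at h2
              rw [hτw]; linarith
          refine ⟨τ w, Or.inr ⟨?_, ?_, (hAua w (Or.inr hw)).1, (hAua w (Or.inr hw)).2⟩⟩
          · intro j p hp hpu
            rcases (hBp j p).1 hp with h | h
            · exact absurd (hpu ▸ (h3p j p h).2.1) hS
            · obtain ⟨_, f', h1, _, h2⟩ := h4p j p h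
              exact le_trans h2 (hend f' (h1.symm.trans hpu))
          · intro q hq
            rcases (hBq _ q).1 hq with h | h
            · exact absurd (h3q _ q h).2.1 hS
            · obtain ⟨_, f', h1, h2⟩ := h4q _ q h
              exact le_trans h2 (hend f' h1.symm)
        · have hwr : ∀ f', e f' = u → u ∈ F := by
            intro f' h
            rcases hef f' with h1 | ⟨w', hw', h1, h2⟩
            · exact h ▸ h1
            · exact absurd ⟨w', hw', h1.symm.trans h⟩ hW'
          by_cases hu : u ∈ F
          · refine ⟨0, Or.inl ⟨?_, ?_, fun j p hp _ => (σB.pieces_bounds j p hp).1,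
              fun q hq => (σB.setup_bounds u q hq).1⟩⟩
            · intro j p hp hpu
              rcases (hAp j p).1 hp with h | h
              · have h1 := h1p j p h
                exact absurd hu (by
                  rw [← hpu, h1.2.1]; exact huaF _ (hkk1 _ h1.1))
              · have h1 := h2p j p h
                exact absurd hu (hHF _ h1.1 _ (hpu ▸ h1.2))
            · intro q hq
              rcases (hAq _ q).1 hq with h | h
              · have h1 := h1q _ q h
                exact absurd hu (by
                  rw [← h1.2.1]; exact huaF _ (hkk1 _ h1.1))
              · have h1 := h2q _ q h
                exact absurd hu (hHF _ h1.1 _ h1.2)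
          · refine ⟨0, Or.inr ⟨?_, ?_, fun j p hp _ => (σA.pieces_bounds j p hp).1,
              fun q hq => (σA.setup_bounds u q hq).1⟩⟩
            · intro j p hp hpu
              rcases (hBp j p).1 hp with h | h
              · exact absurd (hpu ▸ (h3p j p h).2.1) hS
              · obtain ⟨_, f', h1, _, h2⟩ := h4p j p h
                exact absurd (hwr f' (h1.symm.trans hpu)) hu
            · intro q hq
              rcases (hBq _ q).1 hq with h | h
              · exact absurd (h3q _ q h).2.1 hS
              · obtain ⟨_, f', h1, h2⟩ := h4q _ q h
                exact absurd (hwr f' h1.symm) hu)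
  refine ⟨σ', ua, ?_, ?_⟩
  · intro i hi i' hi' h
    exact huai i i' (hkE i (Or.inl hi)) (hkE i' (Or.inl hi')) h
  · intro i hi
    have hiE := hkE i (Or.inl hi)
    have hiQ : i ∈ Q := (hQ i).2 (Or.inl hi)
    have hki : kk i = i := by rw [hkk, if_pos (Or.inl hi)]
    have hi' := (hI0 i).1 hi
    refine ⟨?_, ?_⟩
    · intro j hj p hp
      rcases (hp' j p).1 hp with h | h
      · rcases (hAp j p).1 h with h | h
        · rw [(h1p j p h).2.1, hj, hki]
        · have := (h2p j p h).1
          rw [hj] at this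
          exact absurd this (hI0Hi i hi)
      · have := hBE j p h
        rw [hj] at this
        exact absurd hiE this
    · have l1 : pLoad σ₁ (ua i) = s i + P i := by
        have := h1l i hiQ (by
          intro i' hi'Q h
          have h2 := huai _ _ (hkE _ (hkk1 i' hi'Q)) (hkE _ (hkk1 i hiQ)) h
          rw [hki] at h2
          have := hkI i' hi'Q (by rw [h2]; exact hi)
          rw [this, h2])
        rw [hki] at this
        exact this
      have l2 : pLoad σ₂ (ua i) = 0 := by
        apply aux_pLoad_zero
        · intro j p hp h
          have h1 := h2p j p hp
          exact hHua _ h1.1 i (Or.inl hi) (h ▸ h1.2)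
        · intro q hq
          have h1 := h2q _ q hq
          exact hHua _ h1.1 i (Or.inl hi) h1.2
      have hnf : ∀ f', e f' ≠ ua i := by
        intro f' h
        rcases hef f' with h1 | ⟨w, hw, h1, _⟩
        · exact huaF i (Or.inl hi) (h ▸ h1)
        · have := huai w i (hHZE w (hWH hw)) hiE (h1.symm.trans h)
          exact hI0Z i hi (this ▸ hHZ (hWH hw))
      have l4 : pLoad σ₄ (ua i) = 0 := by
        apply aux_pLoad_zero
        · intro j p hp h
          obtain ⟨_, f', h1, _⟩ := h4p j p hp
          exact hnf f' (h1.symm.trans h)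
        · intro q hq
          obtain ⟨_, f', h1, _⟩ := h4q _ q hq
          exact hnf f' h1.symm
      have l3 : pLoad σ₃ (ua i) ≤ T - s i - P i := by
        by_cases hS : ua i ∈ Sm
        · obtain ⟨i', hi0, hk, hu⟩ := (hSm _).1 hS
          have : i' = i := huai i' i (hkE i' (Or.inl hi0)) hiE hu
          rw [this] at hk
          have h1 := aux_cLoad_sum hT.le hs σ Ch i (fun h => (hCh i).1 h hiE) (P i) (hP i)
            (MM i) (hMM i)
          rw [hMM1 i hk, Finset.sum_singleton, Finset.card_singleton] at h1
          have h2 := h3l (ua i)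
          unfold cLoad at h1
          push_cast at h1
          linarith
        · rw [aux_pLoad_zero]
          · linarith
          · intro j p hp h
            exact hS (h ▸ (h3p j p hp).2.1)
          · intro q hq
            exact hS (h3q _ q hq).2.1
      have l30 := aux_pLoad_nonneg hs σ₃ (ua i)
      rw [hl', hAl, hBl]
      constructor <;> linarith
end
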